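/- arXiv:1609.08592 — 5 statements merged into one kernel-verified Lean document; each statement's English description precedes it below -/
import Mathlib

section
/- Let d ≥ 1 and let Ψ be a quantum channel from d×d complex matrices to matrices on a finite-dimensional output space, given by Kraus operators. Suppose there is a family (U_x), with x ranging over a finite index set of cardinality d², of d×d unitary matrices such that: (i) for every x and every density matrix ρ there exists a unitary matrix V on the output space with Ψ(U_x ρ U_xᴴ) = V Ψ(ρ) Vᴴ; and (ii) ∑_x U_x M U_xᴴ = 0 for every d×d matrix M with trace 0. Then for every density matrix ρ on ℂ^d, S(Ψ(ρ)) ≤ S(Ψ((1/d)·I)). -/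
open Matrix Kronecker BigOperators ComplexOrder

noncomputable section

/-- A density matrix: positive semidefinite with unit trace. -/
def IsDensityMatrix {ι : Type*} [Fintype ι] (ρ : Matrix ι ι ℂ) : Prop :=
  ρ.PosSemidef ∧ ρ.trace = 1

/-- Von Neumann entropy of a (Hermitian) matrix: `∑ i, negMulLog (λ i)`. -/
noncomputable def vnEntropy {ι : Type*} [Fintype ι] [DecidableEq ι] (ρ : Matrix ι ι ℂ) : ℝ :=
  if h : ρ.IsHermitian then ∑ i, Real.negMulLog (h.eigenvalues i) else 0

/-- Action of a quantum channel given by Kraus operators. -/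
noncomputable def chanApply {ι κ X : Type*} [Fintype ι] [Fintype X]
    (K : X → Matrix κ ι ℂ) (ρ : Matrix ι ι ℂ) : Matrix κ κ ℂ :=
  ∑ x, K x * ρ * (K x)ᴴ

theorem sum_normSq_row_of_mem_unitaryGroup {n : Type*} [Fintype n] [DecidableEq n]
    (Q : Matrix.unitaryGroup n ℂ) (k : n) :
    ∑ j, Complex.normSq ((Q : Matrix n n ℂ) k j) = 1 := by
  have h := congrFun (congrFun (Matrix.mem_unitaryGroup_iff.mp Q.2) k) k
  simp only [Matrix.mul_apply, Matrix.star_apply, Matrix.one_apply_eq, RCLike.star_def,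
    Complex.mul_conj] at h
  exact_mod_cast h

theorem sum_normSq_col_of_mem_unitaryGroup {n : Type*} [Fintype n] [DecidableEq n]
    (Q : Matrix.unitaryGroup n ℂ) (j : n) :
    ∑ k, Complex.normSq ((Q : Matrix n n ℂ) k j) = 1 := by
  have h := congrFun (congrFun (Matrix.mem_unitaryGroup_iff'.mp Q.2) j) j
  simp only [Matrix.mul_apply, Matrix.star_apply, Matrix.one_apply_eq, RCLike.star_def,
    mul_comm (starRingEnd ℂ _), Complex.mul_conj] at h
  exact_mod_cast h

theorem mul_diagonal_mul_conjTranspose_apply_self {n : Type*} [Fintype n] [DecidableEq n]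
    (Q : Matrix n n ℂ) (a : n → ℝ) (k : n) :
    (Q * Matrix.diagonal (fun j => (a j : ℂ)) * Qᴴ) k k =
      ((∑ j, Complex.normSq (Q k j) * a j : ℝ) : ℂ) := by
  rw [Matrix.mul_apply]
  push_cast
  refine Finset.sum_congr rfl fun j _ => ?_
  rw [Matrix.mul_diagonal, Matrix.conjTranspose_apply, RCLike.star_def, ← Complex.mul_conj]
  ring

/-- A doubly stochastic averaging increases `∑ i, negMulLog (a i)`. -/
theorem sum_negMulLog_le_of_doublyStochastic {n : Type*} [Fintype n]
    {D : n → n → ℝ} (hD : ∀ k j, 0 ≤ D k j) (hrow : ∀ k, ∑ j, D k j = 1)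
    (hcol : ∀ j, ∑ k, D k j = 1) {a : n → ℝ} (ha : ∀ j, 0 ≤ a j) :
    ∑ j, Real.negMulLog (a j) ≤ ∑ k, Real.negMulLog (∑ j, D k j * a j) :=
  calc ∑ j, Real.negMulLog (a j) = ∑ j, ∑ k, D k j * Real.negMulLog (a j) := by
        simp_rw [← Finset.sum_mul, hcol, one_mul]
    _ = ∑ k, ∑ j, D k j * Real.negMulLog (a j) := Finset.sum_comm
    _ ≤ _ := Finset.sum_le_sum fun k _ =>
        Real.concaveOn_negMulLog.le_map_sum (fun j _ => hD k j) (hrow k) (fun j _ => ha j)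

/-- Mixing unitary conjugates of a positive semidefinite matrix does not decrease its entropy. -/
theorem vnEntropy_le_of_eq_sum_unitary_conj {n X : Type*} [Fintype n] [DecidableEq n] [Fintype X]
    {σ τ : Matrix n n ℂ} (hσ : σ.PosSemidef) (hτ : τ.IsHermitian)
    {w : X → ℝ} (hw : ∀ x, 0 ≤ w x) (hw1 : ∑ x, w x = 1) (V : X → Matrix.unitaryGroup n ℂ)
    (h : τ = ∑ x, (w x : ℂ) • ((V x : Matrix n n ℂ) * σ * (V x : Matrix n n ℂ)ᴴ)) :
    vnEntropy σ ≤ vnEntropy τ := by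
  rw [vnEntropy, vnEntropy, dif_pos hσ.isHermitian, dif_pos hτ]
  set Q : X → Matrix.unitaryGroup n ℂ := fun x =>
    star hτ.eigenvectorUnitary * V x * hσ.isHermitian.eigenvectorUnitary with hQ
  set D : n → n → ℝ := fun k j => ∑ x, w x * Complex.normSq ((Q x : Matrix n n ℂ) k j) with hDdef
  have hspec : σ = (hσ.isHermitian.eigenvectorUnitary : Matrix n n ℂ) *
      Matrix.diagonal (fun j => (hσ.isHermitian.eigenvalues j : ℂ)) *
      (hσ.isHermitian.eigenvectorUnitary : Matrix n n ℂ)ᴴ :=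
    hσ.isHermitian.spectral_theorem
  have hdiag : Matrix.diagonal (fun k => (hτ.eigenvalues k : ℂ)) =
      ∑ x, (w x : ℂ) • ((Q x : Matrix n n ℂ) *
        Matrix.diagonal (fun j => (hσ.isHermitian.eigenvalues j : ℂ)) *
        (Q x : Matrix n n ℂ)ᴴ) := by
    have h1 := hτ.conjStarAlgAut_star_eigenvectorUnitary
    rw [Unitary.conjStarAlgAut_star_apply] at h1
    refine h1.symm.trans ((congrArg (fun A => star (hτ.eigenvectorUnitary : Matrix n n ℂ) * A *
      (hτ.eigenvectorUnitary : Matrix n n ℂ)) h).trans ?_)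
    rw [Finset.mul_sum, Finset.sum_mul]
    refine Finset.sum_congr rfl fun x _ => ?_
    rw [Matrix.mul_smul, Matrix.smul_mul]
    refine congrArg _ ((congrArg (fun A => star (hτ.eigenvectorUnitary : Matrix n n ℂ) *
      ((V x : Matrix n n ℂ) * A * (V x : Matrix n n ℂ)ᴴ) *
      (hτ.eigenvectorUnitary : Matrix n n ℂ)) hspec).trans ?_)
    simp only [hQ, Submonoid.coe_mul, Unitary.coe_star, Matrix.conjTranspose_mul,
      Matrix.star_eq_conjTranspose, Matrix.conjTranspose_conjTranspose, Matrix.mul_assoc]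
  have hev : ∀ k, hτ.eigenvalues k = ∑ j, D k j * hσ.isHermitian.eigenvalues j := by
    intro k
    have h2 := congrFun (congrFun hdiag k) k
    simp only [Matrix.diagonal_apply_eq, Matrix.sum_apply, Matrix.smul_apply,
      mul_diagonal_mul_conjTranspose_apply_self, smul_eq_mul] at h2
    have h3 : hτ.eigenvalues k = ∑ x, w x * ∑ j, Complex.normSq ((Q x : Matrix n n ℂ) k j) *
        hσ.isHermitian.eigenvalues j := by exact_mod_cast h2
    rw [h3]
    simp only [hDdef, Finset.mul_sum, Finset.sum_mul, mul_assoc]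
    exact Finset.sum_comm
  simp_rw [hev]
  refine sum_negMulLog_le_of_doublyStochastic
    (fun k j => Finset.sum_nonneg fun x _ => mul_nonneg (hw x) (Complex.normSq_nonneg _))
    (fun k => ?_) (fun j => ?_) hσ.eigenvalues_nonneg
  · rw [Finset.sum_comm]
    simp_rw [← Finset.mul_sum, sum_normSq_row_of_mem_unitaryGroup, mul_one, hw1]
  · rw [Finset.sum_comm]
    simp_rw [← Finset.mul_sum, sum_normSq_col_of_mem_unitaryGroup, mul_one, hw1]

theorem chanApply_posSemidef {ι κ X : Type*} [Fintype ι] [Finite κ] [Fintype X]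
    (K : X → Matrix κ ι ℂ) {ρ : Matrix ι ι ℂ} (hρ : ρ.PosSemidef) :
    (chanApply K ρ).PosSemidef :=
  Matrix.posSemidef_sum _ fun x _ => hρ.mul_mul_conjTranspose_same (K x)

theorem chanApply_sum_smul {ι κ X Y : Type*} [Fintype ι] [Fintype X] [Fintype Y]
    (K : X → Matrix κ ι ℂ) (c : Y → ℂ) (M : Y → Matrix ι ι ℂ) :
    chanApply K (∑ y, c y • M y) = ∑ y, c y • chanApply K (M y) := by
  simp only [chanApply, Matrix.mul_sum, Matrix.sum_mul, Finset.smul_sum, Matrix.mul_smul,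
    Matrix.smul_mul]
  exact Finset.sum_comm

/-- If the unnormalized twirl annihilates traceless matrices, then the twirl of a trace-one matrix
is maximally mixed. -/
theorem twirl_eq_smul_one {n X : Type*} [Fintype n] [DecidableEq n] [Nonempty n]
    [Fintype X] [Nonempty X]
    (U : X → Matrix.unitaryGroup n ℂ)
    (htwirl : ∀ M : Matrix n n ℂ, M.trace = 0 →
      ∑ x, (U x : Matrix n n ℂ) * M * (U x : Matrix n n ℂ)ᴴ = 0)
    {ρ : Matrix n n ℂ} (hρ : ρ.trace = 1) :
    ∑ x, (((Fintype.card X : ℝ)⁻¹ : ℝ) : ℂ) • ((U x : Matrix n n ℂ) * ρ * (U x : Matrix n n ℂ)ᴴ) =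
      (1 / (Fintype.card n : ℂ)) • (1 : Matrix n n ℂ) := by
  have hn : (Fintype.card n : ℂ) ≠ 0 := Nat.cast_ne_zero.mpr Fintype.card_ne_zero
  have hX : (Fintype.card X : ℂ) ≠ 0 := Nat.cast_ne_zero.mpr Fintype.card_ne_zero
  have h := htwirl (ρ - (1 / (Fintype.card n : ℂ)) • (1 : Matrix n n ℂ)) (by
    rw [Matrix.trace_sub, Matrix.trace_smul, Matrix.trace_one, hρ, smul_eq_mul,
      one_div_mul_cancel hn, sub_self])
  have hU : ∀ x, (U x : Matrix n n ℂ) * (U x : Matrix n n ℂ)ᴴ = 1 := fun x =>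
    Matrix.mem_unitaryGroup_iff.mp (U x).2
  simp only [Matrix.mul_sub, Matrix.sub_mul, Matrix.mul_smul, Matrix.smul_mul, Matrix.mul_one, hU,
    Finset.sum_sub_distrib, Finset.sum_const, Finset.card_univ, sub_eq_zero] at h
  rw [← Finset.smul_sum, h, ← Nat.cast_smul_eq_nsmul ℂ, smul_smul]
  push_cast
  rw [inv_mul_cancel₀ hX, one_smul]

/-- For a generalized covariant channel, the output entropy is maximized on the
maximally mixed input. -/
theorem stmt0 (d : ℕ) (hd : 1 ≤ d) (κ ι X : Type*) [Fintype κ] [DecidableEq κ]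
    [Fintype ι] [Fintype X] (hX : Fintype.card X = d ^ 2)
    (K : ι → Matrix κ (Fin d) ℂ) (hK : ∑ i, (K i)ᴴ * K i = 1)
    (U : X → Matrix.unitaryGroup (Fin d) ℂ)
    (hcov : ∀ x : X, ∀ ρ : Matrix (Fin d) (Fin d) ℂ, IsDensityMatrix ρ →
      ∃ V : Matrix.unitaryGroup κ ℂ,
        chanApply K ((U x : Matrix (Fin d) (Fin d) ℂ) * ρ * (U x : Matrix (Fin d) (Fin d) ℂ)ᴴ)
          = (V : Matrix κ κ ℂ) * chanApply K ρ * (V : Matrix κ κ ℂ)ᴴ)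
    (htwirl : ∀ M : Matrix (Fin d) (Fin d) ℂ, M.trace = 0 →
      ∑ x, (U x : Matrix (Fin d) (Fin d) ℂ) * M * (U x : Matrix (Fin d) (Fin d) ℂ)ᴴ = 0)
    (ρ : Matrix (Fin d) (Fin d) ℂ) (hρ : IsDensityMatrix ρ) :
    vnEntropy (chanApply K ρ) ≤ vnEntropy (chanApply K ((1 / (d : ℂ)) • 1)) := by
  have : NeZero d := ⟨by omega⟩
  have : Nonempty X := Fintype.card_pos_iff.mp (hX ▸ pow_pos hd 2)
  choose V hV using fun x => hcov x ρ hρ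
  have hmix := twirl_eq_smul_one U htwirl hρ.2
  rw [Fintype.card_fin] at hmix
  have hone : ((1 / (d : ℂ)) • (1 : Matrix (Fin d) (Fin d) ℂ)).PosSemidef :=
    Matrix.PosSemidef.one.smul (by positivity)
  refine vnEntropy_le_of_eq_sum_unitary_conj (w := fun _ : X => (Fintype.card X : ℝ)⁻¹)
    (chanApply_posSemidef K hρ.1) (chanApply_posSemidef K hone).isHermitian
    (fun _ => by positivity) (by simp) V ?_
  rw [← hmix, chanApply_sum_smul]
  simp_rw [hV]
end
end

section
/- Let d ≥ 1 and let (U_x)_{x∈X} be a finite nonempty family of d×d unitary matrices such that ∑_x U_x M U_xᴴ = 0 for every d×d complex matrix M with trace 0. Then for every finite type ι_E and every density matrix ρ on the index type Fin d × ι_E, (1/|X|) ∑_x (U_x ⊗ 1) ρ (U_x ⊗ 1)ᴴ = ((1/d)·I) ⊗ ρ_E, where ⊗ is the Kronecker product and ρ_E is the partial trace of ρ over the first factor. In other words, twirling the first subsystem by the family (U_x) replaces it by the maximally mixed state and disentangles it from the second subsystem. -/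
open Matrix Kronecker BigOperators ComplexOrder

noncomputable section

/-- Partial trace over the first tensor factor. -/
def ptraceFst {ιA ιB : Type*} [Fintype ιA] (ρ : Matrix (ιA × ιB) (ιA × ιB) ℂ) :
    Matrix ιB ιB ℂ :=
  fun b b' => ∑ a, ρ (a, b) (a, b')

/-- The block of a bipartite matrix with fixed indices in the second tensor factor. -/
def blockSnd {ιA ιB : Type*} (ρ : Matrix (ιA × ιB) (ιA × ιB) ℂ) (b b' : ιB) :
    Matrix ιA ιA ℂ :=
  ρ.submatrix (fun a => (a, b)) (fun a => (a, b'))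

lemma trace_blockSnd {ιA ιB : Type*} [Fintype ιA] (ρ : Matrix (ιA × ιB) (ιA × ιB) ℂ)
    (b b' : ιB) : (blockSnd ρ b b').trace = ptraceFst ρ b b' :=
  rfl

/-- Conjugation by `V ⊗ 1` acts blockwise as conjugation by `V`. -/
lemma kronecker_one_conj_apply {ιA ιB : Type*} [Fintype ιA] [Fintype ιB] [DecidableEq ιB]
    (V : Matrix ιA ιA ℂ) (ρ : Matrix (ιA × ιB) (ιA × ιB) ℂ) (i j : ιA) (b b' : ιB) :
    ((V ⊗ₖ (1 : Matrix ιB ιB ℂ)) * ρ * (V ⊗ₖ (1 : Matrix ιB ιB ℂ))ᴴ) (i, b) (j, b') =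
      (V * blockSnd ρ b b' * Vᴴ) i j := by
  simp [Matrix.mul_apply, Fintype.sum_prod_type, Matrix.one_apply, blockSnd, apply_ite]

/-- A family of unitaries whose twirl kills traceless matrices sends every matrix to a multiple
of the identity. -/
lemma sum_unitary_conj_eq_smul_one {n X : Type*} [Fintype n] [DecidableEq n] [Nonempty n]
    [Fintype X] (U : X → Matrix.unitaryGroup n ℂ)
    (htwirl : ∀ M : Matrix n n ℂ, M.trace = 0 →
      ∑ x, (U x : Matrix n n ℂ) * M * (U x : Matrix n n ℂ)ᴴ = 0)
    (M : Matrix n n ℂ) :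
    ∑ x, (U x : Matrix n n ℂ) * M * (U x : Matrix n n ℂ)ᴴ =
      (Fintype.card X * (M.trace / Fintype.card n)) • (1 : Matrix n n ℂ) := by
  have hU (x : X) : (U x : Matrix n n ℂ) * (U x : Matrix n n ℂ)ᴴ = 1 :=
    Matrix.mem_unitaryGroup_iff.mp (U x).2
  have h := htwirl (M - (M.trace / Fintype.card n) • (1 : Matrix n n ℂ)) (by simp)
  simp only [mul_sub, sub_mul, Finset.sum_sub_distrib, mul_smul_comm, smul_mul_assoc, mul_one,
    hU, Finset.sum_const, Finset.card_univ, sub_eq_zero] at h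
  rw [h, ← Nat.cast_smul_eq_nsmul ℂ, smul_smul]

/-- Twirling the first subsystem by a one-design family of unitaries replaces it by the
maximally mixed state and disentangles it from the second subsystem. -/
theorem stmt2 (d : ℕ) (hd : 1 ≤ d) (X : Type*) [Fintype X] [Nonempty X]
    (U : X → Matrix.unitaryGroup (Fin d) ℂ)
    (htwirl : ∀ M : Matrix (Fin d) (Fin d) ℂ, M.trace = 0 →
      ∑ x, (U x : Matrix (Fin d) (Fin d) ℂ) * M * (U x : Matrix (Fin d) (Fin d) ℂ)ᴴ = 0)
    (ιE : Type*) [Fintype ιE] [DecidableEq ιE]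
    (ρ : Matrix (Fin d × ιE) (Fin d × ιE) ℂ) (hρ : IsDensityMatrix ρ) :
    (1 / (Fintype.card X : ℂ)) •
        ∑ x, ((U x : Matrix (Fin d) (Fin d) ℂ) ⊗ₖ (1 : Matrix ιE ιE ℂ)) * ρ *
          ((U x : Matrix (Fin d) (Fin d) ℂ) ⊗ₖ (1 : Matrix ιE ιE ℂ))ᴴ
      = ((1 / (d : ℂ)) • (1 : Matrix (Fin d) (Fin d) ℂ)) ⊗ₖ ptraceFst ρ := by
  have : NeZero d := ⟨by omega⟩
  ext ⟨i, b⟩ ⟨j, b'⟩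
  have hX : (Fintype.card X : ℂ) ≠ 0 := by simp
  simp only [Matrix.smul_apply, Matrix.sum_apply, kronecker_one_conj_apply]
  rw [← Matrix.sum_apply, sum_unitary_conj_eq_smul_one U htwirl, trace_blockSnd]
  simp only [Matrix.smul_apply, smul_eq_mul, Matrix.kroneckerMap_apply, Fintype.card_fin]
  field_simp
end
end

section
/- (Quantum data processing inequality.) Let ρ be a density matrix on the index type ι_A × ι_B, let φ_A be a quantum channel from matrices on ℂ^{ι_A} to matrices on ℂ^{ι_{A'}} with Kraus operators (K_i), and let φ_B be a quantum channel from matrices on ℂ^{ι_B} to matrices on ℂ^{ι_{B'}} with Kraus operators (L_j). Let σ = ∑_{i,j} (K_i ⊗ L_j) ρ (K_i ⊗ L_j)ᴴ be the output of the product channel φ_A ⊗ φ_B. Then the quantum mutual information satisfies I(A':B')_σ ≤ I(A:B)_ρ. -/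
open Matrix Kronecker BigOperators ComplexOrder

noncomputable section

/-- Partial trace over the second tensor factor. -/
def ptraceSnd {ιA ιB : Type*} [Fintype ιB] (ρ : Matrix (ιA × ιB) (ιA × ιB) ℂ) :
    Matrix ιA ιA ℂ :=
  fun a a' => ∑ b, ρ (a, b) (a', b)

/-- Quantum mutual information of a bipartite state: `S(ρ_A) + S(ρ_B) − S(ρ)`. -/
noncomputable def mutualInfo {ιA ιB : Type*} [Fintype ιA] [DecidableEq ιA]
    [Fintype ιB] [DecidableEq ιB] (ρ : Matrix (ιA × ιB) (ιA × ιB) ℂ) : ℝ :=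
  vnEntropy (ptraceSnd ρ) + vnEntropy (ptraceFst ρ) - vnEntropy ρ

section

open Filter Topology

theorem hasDerivAt_sum_mul_log_add_mul {ι : Type*} [Fintype ι] {c p q : ι → ℝ}
    (h : ∀ i, c i ≠ 0 → 0 < p i ∧ 0 < q i) {t : ℝ} (ht : 0 ≤ t) :
    HasDerivAt (fun t => ∑ i, c i * (Real.log (q i + t * p i) - Real.log (q i)))
      (∑ i, c i * (p i / (q i + t * p i))) t := by
  refine HasDerivAt.fun_sum fun i _ => ?_
  by_cases hc : c i = 0
  · simpa [hc] using hasDerivAt_const t (0 : ℝ)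
  obtain ⟨hp, hq⟩ := h i hc
  have hlin : HasDerivAt (fun t => q i + t * p i) (p i) t := by
    simpa using ((hasDerivAt_id t).mul_const (p i)).const_add (q i)
  exact ((hlin.log (by positivity)).sub_const _).const_mul _

theorem tendsto_sum_mul_log_add_mul {ι : Type*} [Fintype ι] {c p q : ι → ℝ}
    (h : ∀ i, c i ≠ 0 → 0 < p i ∧ 0 < q i) :
    Tendsto (fun t => ∑ i, c i * (Real.log (q i + t * p i) - Real.log (q i))
      - (∑ i, c i) * Real.log t) atTop
      (𝓝 (∑ i, c i * (Real.log (p i) - Real.log (q i)))) := by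
  simp_rw [Finset.sum_mul, ← Finset.sum_sub_distrib]
  refine tendsto_finsetSum _ fun i _ => ?_
  by_cases hc : c i = 0
  · simp [hc]
  obtain ⟨hp, hq⟩ := h i hc
  have hlim : Tendsto (fun t => q i / t + p i) atTop (𝓝 (p i)) := by
    simpa using (tendsto_const_nhds.div_atTop tendsto_id).add_const (p i)
  refine (((hlim.log hp.ne').sub_const (Real.log (q i))).const_mul (c i)).congr' ?_
  filter_upwards [eventually_gt_atTop 0] with t ht
  have : q i / t + p i = (q i + t * p i) / t := by field_simp
  rw [this, Real.log_div (by positivity) ht.ne']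
  ring

/-- If `∑ c p / (q + t p)` dominates pointwise in `t > 0`, then so does `∑ c (log p - log q)`:
this is the representation `log p - log q = ∫₀^∞ (p / (q + t p) - 1 / (1 + t)) dt`. -/
theorem sum_mul_log_sub_log_le_of_resolvent_le {ι κ : Type*} [Fintype ι] [Fintype κ]
    {c p q : ι → ℝ} {c' p' q' : κ → ℝ}
    (h : ∀ i, c i ≠ 0 → 0 < p i ∧ 0 < q i) (h' : ∀ i, c' i ≠ 0 → 0 < p' i ∧ 0 < q' i)
    (hsum : ∑ i, c' i = ∑ i, c i)
    (hle : ∀ t : ℝ, 0 < t →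
      ∑ i, c' i * (p' i / (q' i + t * p' i)) ≤ ∑ i, c i * (p i / (q i + t * p i))) :
    ∑ i, c' i * (Real.log (p' i) - Real.log (q' i)) ≤
      ∑ i, c i * (Real.log (p i) - Real.log (q i)) := by
  have hmono : MonotoneOn (fun t => ∑ i, c i * (Real.log (q i + t * p i) - Real.log (q i))
      - ∑ i, c' i * (Real.log (q' i + t * p' i) - Real.log (q' i))) (Set.Ici 0) := by
    have hd : ∀ t : ℝ, 0 ≤ t → HasDerivAt _ _ t :=
      fun t ht => (hasDerivAt_sum_mul_log_add_mul h ht).sub (hasDerivAt_sum_mul_log_add_mul h' ht)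
    refine monotoneOn_of_deriv_nonneg (convex_Ici 0)
      (fun t ht => (hd t ht).continuousAt.continuousWithinAt)
      (fun t ht => (hd t (interior_subset ht)).differentiableAt.differentiableWithinAt)
      fun t ht => ?_
    rw [interior_Ici, Set.mem_Ioi] at ht
    have := (hd t ht.le).deriv
    simp only [Pi.sub_def] at this
    rw [this]
    exact sub_nonneg.2 (hle t ht)
  refine sub_nonneg.1 (ge_of_tendsto ((tendsto_sum_mul_log_add_mul h).sub
    (tendsto_sum_mul_log_add_mul h')) ?_)
  filter_upwards [eventually_gt_atTop 0] with t ht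
  have := hmono (Set.mem_Ici.2 le_rfl) (Set.mem_Ici.2 ht.le) ht.le
  simp only [zero_mul, add_zero, sub_self, mul_zero, Finset.sum_const_zero] at this
  rw [hsum]
  linarith

end

namespace Matrix

variable {n m ι : Type*} [Fintype n] [Fintype m] [Fintype ι]

/-- The variational functional whose supremum over `X` is `⟨ρ, (L_σ + t R_ρ)⁻¹ ρ⟩`. -/
def resolventForm (t : ℝ) (ρ σ X : Matrix n n ℂ) : ℝ :=
  2 * (X * ρ).trace.re - (X * Xᴴ * σ).trace.re - t * (Xᴴ * X * ρ).trace.re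

open scoped MatrixOrder in
theorem PosSemidef.trace_mul_re_nonneg {P Q : Matrix n n ℂ}
    (hP : P.PosSemidef) (hQ : Q.PosSemidef) : 0 ≤ (P * Q).trace.re := by
  classical
  obtain ⟨S, rfl⟩ := CStarAlgebra.nonneg_iff_eq_star_mul_self.mp hQ.nonneg
  rw [star_eq_conjTranspose, ← mul_assoc, trace_mul_comm, ← mul_assoc]
  exact (Complex.nonneg_iff.1 (hP.mul_mul_conjTranspose_same S).trace_nonneg).1

/-- The Kadison–Schwarz inequality for the dual of a channel given by Kraus operators. -/
theorem posSemidef_kraus_schwarz [DecidableEq n] {M : ι → Matrix m n ℂ}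
    (hM : ∑ i, (M i)ᴴ * M i = 1) (X : Matrix m m ℂ) :
    (∑ i, (M i)ᴴ * (X * Xᴴ) * M i
      - (∑ i, (M i)ᴴ * X * M i) * (∑ i, (M i)ᴴ * X * M i)ᴴ).PosSemidef := by
  set Y := ∑ i, (M i)ᴴ * X * M i with hY
  have hYH : Yᴴ = ∑ i, (M i)ᴴ * Xᴴ * M i := by
    simp [hY, conjTranspose_sum, Matrix.mul_assoc]
  have key : ∑ i, (M i)ᴴ * (X * Xᴴ) * M i - Y * Yᴴ
      = ∑ i, (Xᴴ * M i - M i * Yᴴ)ᴴ * (Xᴴ * M i - M i * Yᴴ) := by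
    have expand : ∀ i, (Xᴴ * M i - M i * Yᴴ)ᴴ * (Xᴴ * M i - M i * Yᴴ)
        = (M i)ᴴ * (X * Xᴴ) * M i - (M i)ᴴ * X * M i * Yᴴ
          - Y * ((M i)ᴴ * Xᴴ * M i) + Y * ((M i)ᴴ * M i) * Yᴴ := by
      intro i
      simp only [conjTranspose_sub, conjTranspose_mul, conjTranspose_conjTranspose,
        Matrix.mul_sub, Matrix.sub_mul, Matrix.mul_assoc]
      abel
    simp_rw [expand, Finset.sum_add_distrib, Finset.sum_sub_distrib, ← Finset.sum_mul,
      ← Finset.mul_sum]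
    rw [hM, ← hYH, ← hY, mul_one]
    abel
  rw [key]
  exact posSemidef_sum _ fun i _ => posSemidef_conjTranspose_mul_self _

theorem trace_mul_kraus (M : ι → Matrix m n ℂ) (Z : Matrix m m ℂ) (ρ : Matrix n n ℂ) :
    (Z * ∑ i, M i * ρ * (M i)ᴴ).trace = ((∑ i, (M i)ᴴ * Z * M i) * ρ).trace := by
  simp only [Matrix.mul_sum, Matrix.sum_mul, trace_sum]
  refine Finset.sum_congr rfl fun i _ => ?_
  rw [← Matrix.mul_assoc, trace_mul_comm]
  simp only [Matrix.mul_assoc]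

theorem resolventForm_kraus_le [DecidableEq n] {M : ι → Matrix m n ℂ}
    (hM : ∑ i, (M i)ᴴ * M i = 1) {ρ σ : Matrix n n ℂ} (hρ : ρ.PosSemidef) (hσ : σ.PosSemidef)
    {t : ℝ} (ht : 0 ≤ t) (X : Matrix m m ℂ) :
    resolventForm t (∑ i, M i * ρ * (M i)ᴴ) (∑ i, M i * σ * (M i)ᴴ) X
      ≤ resolventForm t ρ σ (∑ i, (M i)ᴴ * X * M i) := by
  have h1 := (posSemidef_kraus_schwarz hM X).trace_mul_re_nonneg hσ
  have h2 := (posSemidef_kraus_schwarz hM Xᴴ).trace_mul_re_nonneg hρ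
  have hadj : ∑ i, (M i)ᴴ * Xᴴ * M i = (∑ i, (M i)ᴴ * X * M i)ᴴ := by
    simp [conjTranspose_sum, Matrix.mul_assoc]
  rw [hadj] at h2
  simp only [conjTranspose_conjTranspose, sub_mul, trace_sub, Complex.sub_re] at h1 h2
  simp only [resolventForm, trace_mul_kraus]
  nlinarith [mul_nonneg ht h2]

theorem resolventForm_diagonalized [DecidableEq n] {U V : Matrix n n ℂ} (hU : Uᴴ * U = 1)
    (hV : Vᴴ * V = 1) (p q : n → ℝ) (t : ℝ) (Y : Matrix n n ℂ) :
    resolventForm t (U * diagonal (fun k => (p k : ℂ)) * Uᴴ)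
        (V * diagonal (fun k => (q k : ℂ)) * Vᴴ) (V * Y * Uᴴ)
      = ∑ x : n × n, (2 * ((Uᴴ * V) x.1 x.2 * Y x.2 x.1).re * p x.1
          - Complex.normSq (Y x.2 x.1) * (q x.2 + t * p x.1)) := by
  have h1 : (V * Y * Uᴴ * (U * diagonal (fun k => (p k : ℂ)) * Uᴴ)).trace
      = ((Uᴴ * V) * Y * diagonal (fun k => (p k : ℂ))).trace := by
    calc _ = (V * Y * (Uᴴ * U) * diagonal (fun k => (p k : ℂ)) * Uᴴ).trace := by
          simp only [mul_assoc]
      _ = _ := by rw [hU, mul_one, trace_mul_comm]; simp only [mul_assoc]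
  have h2 : (V * Y * Uᴴ * (V * Y * Uᴴ)ᴴ * (V * diagonal (fun k => (q k : ℂ)) * Vᴴ)).trace
      = (Y * Yᴴ * diagonal (fun k => (q k : ℂ))).trace := by
    calc _ = (V * (Y * (Uᴴ * U) * Yᴴ * (Vᴴ * V) * diagonal (fun k => (q k : ℂ)) * Vᴴ)).trace := by
          simp only [mul_assoc, conjTranspose_mul, conjTranspose_conjTranspose]
      _ = (Y * Yᴴ * diagonal (fun k => (q k : ℂ)) * (Vᴴ * V)).trace := by
          rw [hU, hV, trace_mul_comm]; simp only [mul_assoc, mul_one, hV]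
      _ = _ := by rw [hV, mul_one]
  have h3 : ((V * Y * Uᴴ)ᴴ * (V * Y * Uᴴ) * (U * diagonal (fun k => (p k : ℂ)) * Uᴴ)).trace
      = (Yᴴ * Y * diagonal (fun k => (p k : ℂ))).trace := by
    calc _ = (U * (Yᴴ * (Vᴴ * V) * Y * (Uᴴ * U) * diagonal (fun k => (p k : ℂ)) * Uᴴ)).trace := by
          simp only [mul_assoc, conjTranspose_mul, conjTranspose_conjTranspose]
      _ = (Yᴴ * Y * diagonal (fun k => (p k : ℂ)) * (Uᴴ * U)).trace := by
          rw [hU, hV, trace_mul_comm]; simp only [mul_assoc, mul_one, hU]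
      _ = _ := by rw [hU, mul_one]
  rw [resolventForm, h1, h2, h3]
  have e1 : ((Uᴴ * V) * Y * diagonal (fun k => (p k : ℂ))).trace.re
      = ∑ x : n × n, ((Uᴴ * V) x.1 x.2 * Y x.2 x.1).re * p x.1 := by
    simp [trace, mul_diagonal, mul_apply (M := Uᴴ * V), Fintype.sum_prod_type, Finset.sum_mul,
      -Complex.mul_re, Complex.re_mul_ofReal]
  have e2 : (Y * Yᴴ * diagonal (fun k => (q k : ℂ))).trace.re
      = ∑ x : n × n, Complex.normSq (Y x.2 x.1) * q x.2 := by
    simp [trace, mul_diagonal, mul_apply (M := Y), Fintype.sum_prod_type_right, Finset.sum_mul,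
      Complex.mul_conj, -Complex.mul_re, Complex.re_mul_ofReal]
  have e3 : (Yᴴ * Y * diagonal (fun k => (p k : ℂ))).trace.re
      = ∑ x : n × n, Complex.normSq (Y x.2 x.1) * p x.1 := by
    simp [trace, mul_diagonal, mul_apply (M := Yᴴ), Fintype.sum_prod_type, Finset.sum_mul,
      ← Complex.normSq_eq_conj_mul_self, -Complex.mul_re, Complex.re_mul_ofReal]
  rw [e1, e2, e3, Finset.mul_sum, Finset.mul_sum, ← Finset.sum_sub_distrib,
    ← Finset.sum_sub_distrib]
  exact Finset.sum_congr rfl fun x _ => by ring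

theorem isGreatest_resolventForm [DecidableEq n] {U V : Matrix n n ℂ}
    (hU : Uᴴ * U = 1) (hV : Vᴴ * V = 1) {p q : n → ℝ} (hp : ∀ k, 0 ≤ p k) (hq : ∀ k, 0 ≤ q k)
    {t : ℝ} (ht : 0 < t) :
    IsGreatest (Set.range (resolventForm t (U * diagonal (fun k => (p k : ℂ)) * Uᴴ)
        (V * diagonal (fun k => (q k : ℂ)) * Vᴴ)))
      (∑ x : n × n, Complex.normSq ((Uᴴ * V) x.1 x.2) * p x.1
        * (p x.1 / (q x.2 + t * p x.1))) := by
  have hpos : ∀ x : n × n, p x.1 = 0 ∨ 0 < q x.2 + t * p x.1 := fun x =>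
    (hp x.1).eq_or_lt.imp Eq.symm fun h => by have := hq x.2; positivity
  constructor
  · refine ⟨V * of (fun l k => ((p k / (q l + t * p k) : ℝ) : ℂ) * star ((Uᴴ * V) k l)) * Uᴴ, ?_⟩
    rw [resolventForm_diagonalized hU hV]
    refine Finset.sum_congr rfl fun x _ => ?_
    rw [of_apply]
    generalize (Uᴴ * V) x.1 x.2 = w
    rcases hpos x with h | h
    · simp [h]
    · have h' := h.ne'
      generalize q x.2 + t * p x.1 = r at h'
      simp only [Complex.normSq_apply, Complex.mul_re, Complex.mul_im, Complex.ofReal_re,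
        Complex.ofReal_im, Complex.star_def, Complex.conj_re, Complex.conj_im]
      field_simp
      ring
  · rintro _ ⟨X, rfl⟩
    have hX : X = V * (Vᴴ * X * U) * Uᴴ := by
      have hU' : U * Uᴴ = 1 := mul_eq_one_comm.1 hU
      have hV' : V * Vᴴ = 1 := mul_eq_one_comm.1 hV
      calc X = (V * Vᴴ) * X * (U * Uᴴ) := by rw [hU', hV', one_mul, mul_one]
        _ = _ := by simp only [mul_assoc]
    rw [hX, resolventForm_diagonalized hU hV]
    refine Finset.sum_le_sum fun x _ => ?_
    generalize (Uᴴ * V) x.1 x.2 = w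
    generalize (Vᴴ * X * U) x.2 x.1 = y
    rcases hpos x with h | h
    · simpa [h] using mul_nonneg (Complex.normSq_nonneg y) (hq x.2)
    · rw [mul_div_assoc', le_div_iff₀ h]
      generalize q x.2 + t * p x.1 = r
      simp only [Complex.normSq_apply, Complex.mul_re]
      nlinarith [sq_nonneg (w.re * p x.1 - r * y.re), sq_nonneg (w.im * p x.1 + r * y.im)]

theorem sum_kronecker_eq {ι κ l m n p : Type*} [Fintype ι] [Fintype κ]
    (f : ι → Matrix l m ℂ) (g : κ → Matrix n p ℂ) :
    ∑ x : ι × κ, f x.1 ⊗ₖ g x.2 = (∑ i, f i) ⊗ₖ (∑ j, g j) := by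
  ext x y
  simp only [Matrix.sum_apply, kroneckerMap_apply, Finset.sum_mul_sum, Fintype.sum_prod_type]

end Matrix

theorem Matrix.PosSemidef.exists_diagonalization {n : Type*} [Fintype n] [DecidableEq n]
    {ρ : Matrix n n ℂ} (hρ : ρ.PosSemidef) :
    ∃ (U : Matrix n n ℂ) (p : n → ℝ), Uᴴ * U = 1 ∧ (∀ k, 0 ≤ p k) ∧
      ρ = U * diagonal (fun k => (p k : ℂ)) * Uᴴ ∧ vnEntropy ρ = ∑ k, Real.negMulLog (p k) := by
  refine ⟨hρ.1.eigenvectorUnitary, hρ.1.eigenvalues, ?_, hρ.eigenvalues_nonneg, ?_, ?_⟩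
  · exact Unitary.coe_star_mul_self hρ.1.eigenvectorUnitary
  · rw [← star_eq_conjTranspose]
    exact hρ.1.spectral_theorem.trans (Unitary.conjStarAlgAut_apply _ _)
  · rw [vnEntropy, dif_pos hρ.1]

section PartialTrace

variable {ιA ιB ιA' ιB' ιK ιL : Type*} [Fintype ιK] [Fintype ιL]

theorem ptraceSnd_sum [Fintype ιB] (ρ : ιK → Matrix (ιA × ιB) (ιA × ιB) ℂ) :
    ptraceSnd (∑ i, ρ i) = ∑ i, ptraceSnd (ρ i) := by
  ext a a'
  simp only [ptraceSnd, Matrix.sum_apply]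
  exact Finset.sum_comm

theorem ptraceFst_sum [Fintype ιA] (ρ : ιK → Matrix (ιA × ιB) (ιA × ιB) ℂ) :
    ptraceFst (∑ i, ρ i) = ∑ i, ptraceFst (ρ i) := by
  ext b b'
  simp only [ptraceFst, Matrix.sum_apply]
  exact Finset.sum_comm

theorem ptraceFst_eq_ptraceSnd_submatrix [Fintype ιA] (ρ : Matrix (ιA × ιB) (ιA × ιB) ℂ) :
    ptraceFst ρ = ptraceSnd (ρ.submatrix Prod.swap Prod.swap) := rfl

theorem ptraceSnd_posSemidef [Fintype ιB] {ρ : Matrix (ιA × ιB) (ιA × ιB) ℂ} (hρ : ρ.PosSemidef) :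
    (ptraceSnd ρ).PosSemidef := by
  have : ptraceSnd ρ = ∑ b, ρ.submatrix (fun a => (a, b)) (fun a => (a, b)) := by
    ext a a'
    simp [ptraceSnd, Matrix.sum_apply]
  rw [this]
  exact posSemidef_sum _ fun b _ => hρ.submatrix _

theorem ptraceFst_posSemidef [Fintype ιA] {ρ : Matrix (ιA × ιB) (ιA × ιB) ℂ} (hρ : ρ.PosSemidef) :
    (ptraceFst ρ).PosSemidef :=
  ptraceSnd_posSemidef (hρ.submatrix Prod.swap)

theorem ptraceSnd_kronecker_conj [Fintype ιA] [Fintype ιB] [Fintype ιB'] [DecidableEq ιB]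
    (K : Matrix ιA' ιA ℂ) {L : ιL → Matrix ιB' ιB ℂ}
    (hL : ∑ j, (L j)ᴴ * L j = 1) (ρ : Matrix (ιA × ιB) (ιA × ιB) ℂ) :
    ∑ j, ptraceSnd ((K ⊗ₖ L j) * ρ * (K ⊗ₖ L j)ᴴ) = K * ptraceSnd ρ * Kᴴ := by
  have entry : ∀ j a a', ptraceSnd ((K ⊗ₖ L j) * ρ * (K ⊗ₖ L j)ᴴ) a a'
      = ∑ z', ∑ z, K a z.1 * star (K a' z'.1) * ρ z z' * ((L j)ᴴ * L j) z'.2 z.2 := by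
    intro j a a'
    simp only [ptraceSnd, mul_apply, conjTranspose_apply, kroneckerMap_apply,
      Finset.sum_mul, Finset.mul_sum, star_mul']
    rw [Finset.sum_comm]
    refine Finset.sum_congr rfl fun z' _ => ?_
    rw [Finset.sum_comm]
    exact Finset.sum_congr rfl fun z _ => Finset.sum_congr rfl fun b _ => by ring
  ext a a'
  simp only [Matrix.sum_apply, entry]
  rw [Finset.sum_comm]
  have hδ : ∀ z' : ιA × ιB,
      ∑ j, ∑ z, K a z.1 * star (K a' z'.1) * ρ z z' * ((L j)ᴴ * L j) z'.2 z.2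
        = ∑ z, K a z.1 * star (K a' z'.1) * ρ z z' * (1 : Matrix ιB ιB ℂ) z'.2 z.2 := by
    intro z'
    rw [Finset.sum_comm]
    simp_rw [← Finset.mul_sum, ← Matrix.sum_apply, hL]
  simp_rw [hδ, Fintype.sum_prod_type, one_apply, mul_apply, ptraceSnd, conjTranspose_apply,
    Finset.sum_mul, Finset.mul_sum, Finset.sum_mul]
  refine Finset.sum_congr rfl fun x' _ => ?_
  rw [Finset.sum_comm]
  refine Finset.sum_congr rfl fun x _ => Finset.sum_congr rfl fun y _ => ?_
  simp
  ring

theorem ptraceFst_kronecker_conj [Fintype ιA] [Fintype ιB] [Fintype ιA'] [DecidableEq ιA]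
    {K : ιK → Matrix ιA' ιA ℂ}
    (hK : ∑ i, (K i)ᴴ * K i = 1) (L : Matrix ιB' ιB ℂ) (ρ : Matrix (ιA × ιB) (ιA × ιB) ℂ) :
    ∑ i, ptraceFst ((K i ⊗ₖ L) * ρ * (K i ⊗ₖ L)ᴴ) = L * ptraceFst ρ * Lᴴ := by
  have hswap : ∀ i, (K i ⊗ₖ L).submatrix Prod.swap Prod.swap = L ⊗ₖ K i := fun i => by
    ext x y
    simp [mul_comm]
  rw [ptraceFst_eq_ptraceSnd_submatrix ρ, ← ptraceSnd_kronecker_conj L hK]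
  refine Finset.sum_congr rfl fun i _ => ?_
  rw [ptraceFst_eq_ptraceSnd_submatrix, ← hswap, conjTranspose_submatrix,
    ← submatrix_mul_equiv _ _ _ (Equiv.prodComm ιB ιA) _,
    ← submatrix_mul_equiv _ _ _ (Equiv.prodComm ιB ιA) _]
  rfl

theorem mutualInfo_resolvent_representation [Fintype ιA] [Fintype ιB] [DecidableEq ιA] [DecidableEq ιB]
    {ρ : Matrix (ιA × ιB) (ιA × ιB) ℂ} (hρ : IsDensityMatrix ρ) :
    ∃ c p q : (ιA × ιB) × (ιA × ιB) → ℝ,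
      (∀ x, c x ≠ 0 → 0 < p x ∧ 0 < q x) ∧ ∑ x, c x = 1 ∧
      mutualInfo ρ = ∑ x, c x * (Real.log (p x) - Real.log (q x)) ∧
      ∀ t : ℝ, 0 < t → IsGreatest
        (Set.range (resolventForm t ρ (ptraceSnd ρ ⊗ₖ ptraceFst ρ)))
        (∑ x, c x * (p x / (q x + t * p x))) := by
  obtain ⟨U, p, hU, hp, hρU, hS⟩ := hρ.1.exists_diagonalization
  obtain ⟨A, α, hA, hα, hρA, hSA⟩ := (ptraceSnd_posSemidef hρ.1).exists_diagonalization
  obtain ⟨B, β, hB, hβ, hρB, hSB⟩ := (ptraceFst_posSemidef hρ.1).exists_diagonalization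
  have hV : (A ⊗ₖ B)ᴴ * (A ⊗ₖ B) = 1 := by
    rw [conjTranspose_kronecker, ← mul_kronecker_mul, hA, hB, one_kronecker_one]
  have hprod : ptraceSnd ρ ⊗ₖ ptraceFst ρ = (A ⊗ₖ B)
      * diagonal (fun l : ιA × ιB => ((α l.1 * β l.2 : ℝ) : ℂ)) * (A ⊗ₖ B)ᴴ := by
    rw [hρA, hρB, mul_kronecker_mul, mul_kronecker_mul, diagonal_kronecker_diagonal,
      conjTranspose_kronecker]
    simp
  set W := Uᴴ * (A ⊗ₖ B) with hW
  set c : (ιA × ιB) × (ιA × ιB) → ℝ := fun x => Complex.normSq (W x.1 x.2) * p x.1 with hc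
  have hc0 : ∀ x, 0 ≤ c x := fun x => mul_nonneg (Complex.normSq_nonneg _) (hp _)
  have hWW : W * Wᴴ = 1 := by
    rw [hW, conjTranspose_mul, conjTranspose_conjTranspose, mul_assoc, ← mul_assoc (A ⊗ₖ B),
      mul_eq_one_comm.1 hV, one_mul, hU]
  have hrow : ∀ k, ∑ l, c (k, l) = p k := by
    intro k
    have : ((∑ l, Complex.normSq (W k l) : ℝ) : ℂ) = 1 := by
      have := congrFun (congrFun hWW k) k
      simpa [mul_apply, Complex.mul_conj] using this
    simp only [hc]
    rw [← Finset.sum_mul, show ∑ l, Complex.normSq (W k l) = 1 by exact_mod_cast this, one_mul]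
  have hcol : ∀ l, ((∑ k, c (k, l) : ℝ) : ℂ) = ((A ⊗ₖ B)ᴴ * ρ * (A ⊗ₖ B)) l l := by
    intro l
    have : (A ⊗ₖ B)ᴴ * ρ * (A ⊗ₖ B) = Wᴴ * diagonal (fun k => (p k : ℂ)) * W := by
      conv_lhs => rw [hρU]
      rw [hW, conjTranspose_mul, conjTranspose_conjTranspose]
      simp only [mul_assoc]
    rw [this, mul_apply]
    simp only [hc, mul_diagonal, conjTranspose_apply, Complex.ofReal_sum, Complex.ofReal_mul,
      ← Complex.mul_conj, Complex.star_def]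
    exact Finset.sum_congr rfl fun k _ => by ring
  have hmargA : ∀ i, ∑ j, ∑ k, c (k, (i, j)) = α i := by
    intro i
    have h := congrFun (congrFun (ptraceSnd_kronecker_conj Aᴴ (L := fun _ : Unit => Bᴴ)
      (by simpa using mul_eq_one_comm.1 hB) ρ) i) i
    rw [hρA] at h
    have e : Aᴴ * (A * diagonal (fun k => (α k : ℂ)) * Aᴴ) * Aᴴᴴ
        = diagonal (fun k => (α k : ℂ)) := by
      rw [conjTranspose_conjTranspose, mul_assoc, mul_assoc, mul_assoc, hA, mul_one, ← mul_assoc,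
        hA, one_mul]
    rw [e] at h
    simp only [Finset.univ_unique, Finset.sum_singleton, ptraceSnd, ← conjTranspose_kronecker,
      conjTranspose_conjTranspose, ← hcol, diagonal_apply_eq] at h
    exact_mod_cast h
  have hmargB : ∀ j, ∑ i, ∑ k, c (k, (i, j)) = β j := by
    intro j
    have h := congrFun (congrFun (ptraceFst_kronecker_conj (K := fun _ : Unit => Aᴴ)
      (by simpa using mul_eq_one_comm.1 hA) Bᴴ ρ) j) j
    rw [hρB] at h
    have e : Bᴴ * (B * diagonal (fun k => (β k : ℂ)) * Bᴴ) * Bᴴᴴ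
        = diagonal (fun k => (β k : ℂ)) := by
      rw [conjTranspose_conjTranspose, mul_assoc, mul_assoc, mul_assoc, hB, mul_one, ← mul_assoc,
        hB, one_mul]
    rw [e] at h
    simp only [Finset.univ_unique, Finset.sum_singleton, ptraceFst, ← conjTranspose_kronecker,
      conjTranspose_conjTranspose, ← hcol, diagonal_apply_eq] at h
    exact_mod_cast h
  have hleA : ∀ k i j, c (k, (i, j)) ≤ α i := fun k i j => by
    rw [← hmargA i]
    exact (Finset.single_le_sum (f := fun k => c (k, (i, j))) (fun _ _ => hc0 _)
      (Finset.mem_univ k)).trans (Finset.single_le_sum (f := fun j => ∑ k, c (k, (i, j)))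
        (fun _ _ => Finset.sum_nonneg fun _ _ => hc0 _) (Finset.mem_univ j))
  have hleB : ∀ k i j, c (k, (i, j)) ≤ β j := fun k i j => by
    rw [← hmargB j]
    exact (Finset.single_le_sum (f := fun k => c (k, (i, j))) (fun _ _ => hc0 _)
      (Finset.mem_univ k)).trans (Finset.single_le_sum (f := fun i => ∑ k, c (k, (i, j)))
        (fun _ _ => Finset.sum_nonneg fun _ _ => hc0 _) (Finset.mem_univ i))
  have hsupp : ∀ k i j, c (k, (i, j)) ≠ 0 → 0 < α i ∧ 0 < β j := fun k i j h =>
    have h := (hc0 _).lt_of_ne' h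
    ⟨h.trans_le (hleA k i j), h.trans_le (hleB k i j)⟩
  refine ⟨c, fun x => p x.1, fun x => α x.2.1 * β x.2.2, ?_, ?_, ?_, ?_⟩
  · rintro ⟨k, i, j⟩ h
    obtain ⟨h1, h2⟩ := hsupp k i j h
    exact ⟨(hp k).lt_of_ne' (right_ne_zero_of_mul h), mul_pos h1 h2⟩
  · rw [Fintype.sum_prod_type]
    simp_rw [hrow]
    have h := hρ.2
    rw [hρU, trace_mul_comm, ← mul_assoc, hU, one_mul, trace_diagonal] at h
    exact_mod_cast h
  · have hlog : ∀ x : (ιA × ιB) × (ιA × ιB),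
        c x * (Real.log (p x.1) - Real.log (α x.2.1 * β x.2.2))
          = c x * Real.log (p x.1) - c x * Real.log (α x.2.1) - c x * Real.log (β x.2.2) := by
      rintro ⟨k, i, j⟩
      by_cases h : c (k, i, j) = 0
      · simp [h]
      obtain ⟨h1, h2⟩ := hsupp k i j h
      simp only [Real.log_mul h1.ne' h2.ne']
      ring
    have e1 : ∑ x, c x * Real.log (p x.1) = - ∑ k, Real.negMulLog (p k) := by
      rw [Fintype.sum_prod_type, ← Finset.sum_neg_distrib]
      refine Finset.sum_congr rfl fun k _ => ?_
      simp only [← Finset.sum_mul, hrow, Real.negMulLog]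
      ring
    have e2 : ∑ x, c x * Real.log (α x.2.1) = - ∑ i, Real.negMulLog (α i) := by
      rw [Fintype.sum_prod_type_right, Fintype.sum_prod_type, ← Finset.sum_neg_distrib]
      refine Finset.sum_congr rfl fun i _ => ?_
      simp only [← Finset.sum_mul, hmargA, Real.negMulLog]
      ring
    have e3 : ∑ x, c x * Real.log (β x.2.2) = - ∑ j, Real.negMulLog (β j) := by
      rw [Fintype.sum_prod_type_right, Fintype.sum_prod_type_right, ← Finset.sum_neg_distrib]
      refine Finset.sum_congr rfl fun j _ => ?_
      simp only [← Finset.sum_mul, hmargB, Real.negMulLog]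
      ring
    simp_rw [hlog, Finset.sum_sub_distrib]
    rw [e1, e2, e3, mutualInfo, hS, hSA, hSB]
    ring
  · intro t ht
    rw [hprod]
    conv in resolventForm t ρ _ => rw [hρU]
    exact isGreatest_resolventForm hU hV hp (fun l => mul_nonneg (hα _) (hβ _)) ht

theorem sum_conjTranspose_kronecker_mul_self [Fintype ιA'] [Fintype ιB'] [DecidableEq ιA] [DecidableEq ιB]
    {K : ιK → Matrix ιA' ιA ℂ} (hK : ∑ i, (K i)ᴴ * K i = 1)
    {L : ιL → Matrix ιB' ιB ℂ} (hL : ∑ j, (L j)ᴴ * L j = 1) :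
    ∑ x : ιK × ιL, (K x.1 ⊗ₖ L x.2)ᴴ * (K x.1 ⊗ₖ L x.2) = 1 := by
  simp_rw [conjTranspose_kronecker, ← mul_kronecker_mul]
  rw [sum_kronecker_eq (fun i => (K i)ᴴ * K i) (fun j => (L j)ᴴ * L j), hK, hL, one_kronecker_one]

theorem kronecker_channel_apply_kronecker [Fintype ιA] [Fintype ιB]
    (K : ιK → Matrix ιA' ιA ℂ) (L : ιL → Matrix ιB' ιB ℂ)
    (ρA : Matrix ιA ιA ℂ) (ρB : Matrix ιB ιB ℂ) :
    ∑ x : ιK × ιL, (K x.1 ⊗ₖ L x.2) * (ρA ⊗ₖ ρB) * (K x.1 ⊗ₖ L x.2)ᴴ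
      = (∑ i, K i * ρA * (K i)ᴴ) ⊗ₖ (∑ j, L j * ρB * (L j)ᴴ) := by
  simp_rw [conjTranspose_kronecker, ← mul_kronecker_mul]
  exact sum_kronecker_eq (fun i => K i * ρA * (K i)ᴴ) (fun j => L j * ρB * (L j)ᴴ)

end PartialTrace

/-- Quantum data processing inequality: local channels on each share of a bipartite state
do not increase the quantum mutual information. -/
theorem stmt3 {ιA ιB ιA' ιB' ιK ιL : Type*}
    [Fintype ιA] [DecidableEq ιA] [Fintype ιB] [DecidableEq ιB]
    [Fintype ιA'] [DecidableEq ιA'] [Fintype ιB'] [DecidableEq ιB']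
    [Fintype ιK] [Fintype ιL]
    (ρ : Matrix (ιA × ιB) (ιA × ιB) ℂ) (hρ : IsDensityMatrix ρ)
    (K : ιK → Matrix ιA' ιA ℂ) (hK : ∑ i, (K i)ᴴ * K i = 1)
    (L : ιL → Matrix ιB' ιB ℂ) (hL : ∑ j, (L j)ᴴ * L j = 1)
    (σ : Matrix (ιA' × ιB') (ιA' × ιB') ℂ)
    (hσ : σ = ∑ i, ∑ j, (K i ⊗ₖ L j) * ρ * (K i ⊗ₖ L j)ᴴ) :
    mutualInfo σ ≤ mutualInfo ρ := by
  set M : ιK × ιL → Matrix (ιA' × ιB') (ιA × ιB) ℂ := fun x => K x.1 ⊗ₖ L x.2 with hM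
  have hM1 : ∑ x, (M x)ᴴ * M x = 1 := sum_conjTranspose_kronecker_mul_self hK hL
  have hσM : σ = ∑ x, M x * ρ * (M x)ᴴ := by rw [hσ, Fintype.sum_prod_type]
  have hσA : ptraceSnd σ = ∑ i, K i * ptraceSnd ρ * (K i)ᴴ := by
    rw [hσ, ptraceSnd_sum]
    exact Finset.sum_congr rfl fun i _ => by rw [ptraceSnd_sum, ptraceSnd_kronecker_conj _ hL]
  have hσB : ptraceFst σ = ∑ j, L j * ptraceFst ρ * (L j)ᴴ := by
    rw [hσ, Finset.sum_comm, ptraceFst_sum]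
    exact Finset.sum_congr rfl fun j _ => by rw [ptraceFst_sum, ptraceFst_kronecker_conj hK]
  have hσD : IsDensityMatrix σ := by
    refine ⟨hσM ▸ posSemidef_sum _ fun x _ => hρ.1.mul_mul_conjTranspose_same _, ?_⟩
    have := trace_mul_kraus M 1 ρ
    simpa only [Matrix.one_mul, Matrix.mul_one, ← hσM, hM1, hρ.2] using this
  obtain ⟨c, p, q, hpos, hsum, hI, hsup⟩ := mutualInfo_resolvent_representation hρ
  obtain ⟨c', p', q', hpos', hsum', hI', hsup'⟩ := mutualInfo_resolvent_representation hσD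
  rw [hI, hI']
  refine sum_mul_log_sub_log_le_of_resolvent_le hpos hpos' (hsum'.trans hsum.symm) fun t ht => ?_
  obtain ⟨X, hX⟩ := (hsup' t ht).1
  rw [← hX, hσA, hσB, ← kronecker_channel_apply_kronecker]
  conv_lhs => rw [hσM]
  exact (resolventForm_kraus_le hM1 hρ.1
    ((ptraceSnd_posSemidef hρ.1).kronecker (ptraceFst_posSemidef hρ.1)) ht.le X).trans
    ((hsup t ht).2 ⟨_, rfl⟩)
end
end

section
/- (Conditional quantum data processing inequality.) Let ρ be a density matrix on the index type ι_A × ι_B × ι_C, let φ_A be a quantum channel from matrices on ℂ^{ι_A} to matrices on ℂ^{ι_{A'}} with Kraus operators (K_i), and let φ_B be a quantum channel from matrices on ℂ^{ι_B} to matrices on ℂ^{ι_{B'}} with Kraus operators (L_j). Let σ = ∑_{i,j} (K_i ⊗ L_j ⊗ 1_C) ρ (K_i ⊗ L_j ⊗ 1_C)ᴴ be the output of the channel (φ_A ⊗ φ_B ⊗ id_C) that acts locally on A and B and leaves C unchanged. Then the conditional quantum mutual information satisfies I(A':B'|C)_σ ≤ I(A:B|C)_ρ. -/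
open Matrix Kronecker BigOperators ComplexOrder

noncomputable section

/-- Reduced state on `A × C` of a tripartite state on `A × B × C`. -/
def reduceAC {ιA ιB ιC : Type*} [Fintype ιB]
    (ρ : Matrix (ιA × ιB × ιC) (ιA × ιB × ιC) ℂ) : Matrix (ιA × ιC) (ιA × ιC) ℂ :=
  fun p q => ∑ b, ρ (p.1, (b, p.2)) (q.1, (b, q.2))

/-- Reduced state on `B × C` of a tripartite state on `A × B × C`. -/
def reduceBC {ιA ιB ιC : Type*} [Fintype ιA]
    (ρ : Matrix (ιA × ιB × ιC) (ιA × ιB × ιC) ℂ) : Matrix (ιB × ιC) (ιB × ιC) ℂ :=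
  fun p q => ∑ a, ρ (a, p) (a, q)

/-- Reduced state on `C` of a tripartite state on `A × B × C`. -/
def reduceC {ιA ιB ιC : Type*} [Fintype ιA] [Fintype ιB]
    (ρ : Matrix (ιA × ιB × ιC) (ιA × ιB × ιC) ℂ) : Matrix ιC ιC ℂ :=
  fun c c' => ∑ a, ∑ b, ρ (a, (b, c)) (a, (b, c'))

/-- Conditional quantum mutual information `I(A:B|C) = S(AC) + S(BC) − S(ABC) − S(C)`. -/
noncomputable def condMutualInfo {ιA ιB ιC : Type*}
    [Fintype ιA] [DecidableEq ιA] [Fintype ιB] [DecidableEq ιB] [Fintype ιC] [DecidableEq ιC]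
    (ρ : Matrix (ιA × ιB × ιC) (ιA × ιB × ιC) ℂ) : ℝ :=
  vnEntropy (reduceAC ρ) + vnEntropy (reduceBC ρ) - vnEntropy ρ - vnEntropy (reduceC ρ)

open Filter Topology

section RealAnalysis

variable {ι : Type*} {a p q : ι → ℝ}

theorem pos_and_pos_of_mul_ne_zero (hp : ∀ i, 0 ≤ p i) (hq : ∀ i, 0 ≤ q i)
    (ha : ∀ i, q i = 0 → a i * p i = 0) {i : ι} (hi : a i * p i ≠ 0) : 0 < p i ∧ 0 < q i :=
  ⟨(hp i).lt_of_ne' (right_ne_zero_of_mul hi), (hq i).lt_of_ne' fun h0 => hi (ha i h0)⟩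

variable [Fintype ι]

theorem continuousOn_sum_mul_log (hp : ∀ i, 0 ≤ p i) (hq : ∀ i, 0 ≤ q i)
    (ha : ∀ i, q i = 0 → a i * p i = 0) :
    ContinuousOn (fun t : ℝ => ∑ i, a i * p i * Real.log (q i + t * p i)) (Set.Ici 0) := by
  refine continuousOn_finsetSum _ fun i _ => ?_
  by_cases hi : a i * p i = 0
  · simp only [hi, zero_mul]; exact continuousOn_const
  · obtain ⟨h1, h2⟩ := pos_and_pos_of_mul_ne_zero hp hq ha hi
    refine continuousOn_const.mul (ContinuousOn.log (by fun_prop) fun t ht => ?_)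
    have : 0 ≤ t := ht
    positivity

theorem hasDerivAt_sum_mul_log (hp : ∀ i, 0 ≤ p i) (hq : ∀ i, 0 ≤ q i)
    (ha : ∀ i, q i = 0 → a i * p i = 0) {t : ℝ} (ht : 0 < t) :
    HasDerivAt (fun t : ℝ => ∑ i, a i * p i * Real.log (q i + t * p i))
      (∑ i, a i * (p i ^ 2 / (q i + t * p i))) t := by
  refine HasDerivAt.fun_sum fun i _ => ?_
  by_cases hi : a i * p i = 0
  · have : a i * (p i ^ 2 / (q i + t * p i)) = 0 := by
      rw [show a i * (p i ^ 2 / (q i + t * p i)) = a i * p i * (p i / (q i + t * p i)) by ring,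
        hi, zero_mul]
    simp only [hi, zero_mul, this]; exact hasDerivAt_const _ _
  · obtain ⟨h1, h2⟩ := pos_and_pos_of_mul_ne_zero hp hq ha hi
    have hd : HasDerivAt (fun t : ℝ => q i + t * p i) (p i) t := by
      simpa using ((hasDerivAt_id t).mul_const (p i)).const_add (q i)
    exact ((hd.log (by positivity)).const_mul (a i * p i)).congr_deriv (by ring)

theorem tendsto_sum_mul_log_sub (hp : ∀ i, 0 ≤ p i) (hq : ∀ i, 0 ≤ q i)
    (ha : ∀ i, q i = 0 → a i * p i = 0) :
    Tendsto (fun t : ℝ => (∑ i, a i * p i * Real.log (q i + t * p i))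
      - (∑ i, a i * p i) * Real.log t) atTop (𝓝 (∑ i, a i * p i * Real.log (p i))) := by
  have : ∀ i, Tendsto (fun t : ℝ => a i * p i * (Real.log (q i * t⁻¹ + p i))) atTop
      (𝓝 (a i * p i * Real.log (p i))) := by
    intro i
    by_cases hi : a i * p i = 0
    · simp only [hi, zero_mul]; exact tendsto_const_nhds
    · obtain ⟨h1, h2⟩ := pos_and_pos_of_mul_ne_zero hp hq ha hi
      refine Tendsto.const_mul _ (Tendsto.log ?_ h1.ne')
      simpa using (tendsto_inv_atTop_zero.const_mul (q i)).add_const (p i)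
  refine (tendsto_finsetSum _ fun i _ => this i).congr' ?_
  filter_upwards [eventually_gt_atTop 0] with t ht
  rw [Finset.sum_mul, ← Finset.sum_sub_distrib]
  refine Finset.sum_congr rfl fun i _ => ?_
  by_cases hi : a i * p i = 0
  · simp [hi]
  · obtain ⟨h1, h2⟩ := pos_and_pos_of_mul_ne_zero hp hq ha hi
    rw [← mul_sub, ← Real.log_div (by positivity) ht.ne']
    congr 2
    field_simp

/-- Comparing the quasi-entropies `∑ a p² / (q + t p)` for all `t > 0` compares the relative
entropies `∑ a p (log p - log q)`, by integrating over `t`. -/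
theorem sum_mul_log_le_of_quasi_le {κ : Type*} [Fintype κ] {b r s : κ → ℝ}
    (hp : ∀ i, 0 ≤ p i) (hq : ∀ i, 0 ≤ q i) (hr : ∀ i, 0 ≤ r i) (hs : ∀ i, 0 ≤ s i)
    (ha : ∀ i, q i = 0 → a i * p i = 0) (hb : ∀ i, s i = 0 → b i * r i = 0)
    (hsum : ∑ i, a i * p i = ∑ i, b i * r i)
    (h : ∀ t : ℝ, 0 < t →
      ∑ i, b i * (r i ^ 2 / (s i + t * r i)) ≤ ∑ i, a i * (p i ^ 2 / (q i + t * p i))) :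
    ∑ i, b i * r i * (Real.log (r i) - Real.log (s i)) ≤
      ∑ i, a i * p i * (Real.log (p i) - Real.log (q i)) := by
  have hd : ∀ t : ℝ, 0 < t → HasDerivAt _ _ t := fun t ht =>
    (hasDerivAt_sum_mul_log hp hq ha ht).fun_sub (hasDerivAt_sum_mul_log hr hs hb ht)
  have hmono : MonotoneOn (fun t : ℝ => (∑ i, a i * p i * Real.log (q i + t * p i))
      - ∑ i, b i * r i * Real.log (s i + t * r i)) (Set.Ici 0) := by
    refine monotoneOn_of_deriv_nonneg (convex_Ici 0)
      ((continuousOn_sum_mul_log hp hq ha).sub (continuousOn_sum_mul_log hr hs hb)) ?_ ?_ <;>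
      rw [interior_Ici] <;> intro t ht
    · exact (hd t ht).differentiableAt.differentiableWithinAt
    · rw [(hd t ht).deriv]
      linarith [h t ht]
  have hlim := ge_of_tendsto
    ((tendsto_sum_mul_log_sub hp hq ha).sub (tendsto_sum_mul_log_sub hr hs hb))
    (b := (∑ i, a i * p i * Real.log (q i)) - ∑ i, b i * r i * Real.log (s i)) (by
      filter_upwards [eventually_ge_atTop 0] with t ht
      have := hmono (Set.mem_Ici.2 le_rfl) (Set.mem_Ici.2 ht) ht
      simp only [zero_mul, add_zero] at this
      rw [hsum]
      linarith)
  simp only [mul_sub, Finset.sum_sub_distrib]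
  linarith

end RealAnalysis

section QuasiEntropy

variable {m n κ : Type*} [Fintype m] [Fintype n] [Fintype κ]

/-- The functional of `X` whose maximum is the quasi-entropy
`⟨ρ, (σ · + t · ρ)⁻¹ ρ⟩` of `ρ` relative to `σ`. -/
def quasiEntropyForm (ρ σ : Matrix n n ℂ) (t : ℝ) (X : Matrix n n ℂ) : ℝ :=
  2 * (Xᴴ * ρ).trace.re - (σ * (X * Xᴴ)).trace.re - t * (ρ * (Xᴴ * X)).trace.re

/-- The image of `ρ` under the completely positive map with Kraus operators `N`. -/
def krausMap (N : κ → Matrix m n ℂ) (ρ : Matrix n n ℂ) : Matrix m m ℂ :=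
  ∑ k, N k * ρ * (N k)ᴴ

theorem krausMap_posSemidef (N : κ → Matrix m n ℂ) {ρ : Matrix n n ℂ} (hρ : ρ.PosSemidef) :
    (krausMap N ρ).PosSemidef :=
  posSemidef_sum _ fun k _ => hρ.mul_mul_conjTranspose_same (N k)

theorem trace_krausMap_mul (N : κ → Matrix m n ℂ) (ρ : Matrix n n ℂ) (X : Matrix m m ℂ) :
    (krausMap N ρ * X).trace = (ρ * krausMap (fun k => (N k)ᴴ) X).trace := by
  simp only [krausMap, Finset.sum_mul, Finset.mul_sum, trace_sum, conjTranspose_conjTranspose]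
  refine Finset.sum_congr rfl fun k _ => ?_
  rw [Matrix.mul_assoc, Matrix.mul_assoc, trace_mul_comm, Matrix.mul_assoc]

omit [Fintype m] in
theorem conjTranspose_krausMap (N : κ → Matrix m n ℂ) (ρ : Matrix n n ℂ) :
    (krausMap N ρ)ᴴ = krausMap N ρᴴ := by
  simp [krausMap, conjTranspose_sum, Matrix.mul_assoc]

theorem trace_krausMap [DecidableEq n] {N : κ → Matrix m n ℂ} (hN : ∑ k, (N k)ᴴ * N k = 1)
    (ρ : Matrix n n ℂ) : (krausMap N ρ).trace = ρ.trace := by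
  classical
  rw [← Matrix.mul_one (krausMap N ρ), trace_krausMap_mul]
  simp [krausMap, hN]

/-- The Kadison-Schwarz inequality for the dual of a quantum channel. -/
theorem krausMap_conjTranspose_schwarz [DecidableEq n] {N : κ → Matrix m n ℂ}
    (hN : ∑ k, (N k)ᴴ * N k = 1) (X : Matrix m m ℂ) :
    (krausMap (fun k => (N k)ᴴ) (X * Xᴴ) -
      krausMap (fun k => (N k)ᴴ) X * (krausMap (fun k => (N k)ᴴ) X)ᴴ).PosSemidef := by
  set Y := krausMap (fun k => (N k)ᴴ) X with hY
  have hY1 : ∑ k, (N k)ᴴ * X * N k = Y := by simp [hY, krausMap]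
  have hY2 : ∑ k, (N k)ᴴ * Xᴴ * N k = Yᴴ := by
    rw [hY, conjTranspose_krausMap]; simp [krausMap]
  have key : krausMap (fun k => (N k)ᴴ) (X * Xᴴ) - Y * Yᴴ =
      ∑ k, (Xᴴ * N k - N k * Yᴴ)ᴴ * (Xᴴ * N k - N k * Yᴴ) := by
    have : ∀ k, (Xᴴ * N k - N k * Yᴴ)ᴴ * (Xᴴ * N k - N k * Yᴴ) =
        (N k)ᴴ * (X * Xᴴ) * N k - ((N k)ᴴ * X * N k) * Yᴴ
          - Y * ((N k)ᴴ * Xᴴ * N k) + Y * ((N k)ᴴ * N k) * Yᴴ := by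
      intro k
      simp only [conjTranspose_sub, conjTranspose_mul, conjTranspose_conjTranspose,
        Matrix.sub_mul, Matrix.mul_sub, Matrix.mul_assoc]
      abel
    simp only [this, Finset.sum_add_distrib, Finset.sum_sub_distrib, ← Finset.sum_mul,
      ← Finset.mul_sum, hY1, hY2, hN, Matrix.mul_one]
    simp [krausMap]
  rw [key]
  exact posSemidef_sum _ fun k _ => posSemidef_conjTranspose_mul_self _

open scoped MatrixOrder in
theorem re_trace_mul_nonneg {A B : Matrix n n ℂ} (hA : A.PosSemidef) (hB : B.PosSemidef) :
    0 ≤ (A * B).trace.re := by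
  classical
  obtain ⟨C, rfl⟩ := CStarAlgebra.nonneg_iff_eq_star_mul_self.1 hB.nonneg
  rw [← Matrix.mul_assoc, trace_mul_comm, ← Matrix.mul_assoc]
  exact (Complex.le_def.1 (hA.mul_mul_conjTranspose_same C).trace_nonneg).1

theorem quasiEntropyForm_krausMap_le [DecidableEq n] {N : κ → Matrix m n ℂ}
    (hN : ∑ k, (N k)ᴴ * N k = 1) {ρ σ : Matrix n n ℂ} (hρ : ρ.PosSemidef) (hσ : σ.PosSemidef)
    {t : ℝ} (ht : 0 ≤ t) (X : Matrix m m ℂ) :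
    quasiEntropyForm (krausMap N ρ) (krausMap N σ) t X ≤
      quasiEntropyForm ρ σ t (krausMap (fun k => (N k)ᴴ) X) := by
  have h1 := re_trace_mul_nonneg hσ (krausMap_conjTranspose_schwarz hN X)
  have h2 := re_trace_mul_nonneg hρ (krausMap_conjTranspose_schwarz hN Xᴴ)
  rw [Matrix.mul_sub, trace_sub, Complex.sub_re] at h1 h2
  simp only [conjTranspose_krausMap, conjTranspose_conjTranspose] at h1 h2
  have h3 := mul_nonneg ht h2
  simp only [quasiEntropyForm, trace_mul_comm Xᴴ, trace_krausMap_mul, conjTranspose_krausMap,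
    trace_mul_comm (krausMap (fun k => (N k)ᴴ) Xᴴ) ρ]
  linarith

variable [DecidableEq n] [DecidableEq m]

/-- `A = U diag(p) Uᴴ` with `U` unitary. -/
def IsDiagonalizedBy (A U : Matrix n n ℂ) (p : n → ℝ) : Prop :=
  U ∈ unitaryGroup n ℂ ∧ A = U * diagonal (fun i => (p i : ℂ)) * Uᴴ

theorem quasiEntropyForm_eq_sum {ρ σ U V : Matrix n n ℂ} {p q : n → ℝ}
    (hρ : IsDiagonalizedBy ρ U p) (hσ : IsDiagonalizedBy σ V q) (t : ℝ) (Z : Matrix n n ℂ) :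
    quasiEntropyForm ρ σ t (V * Z * Uᴴ) = ∑ j, ∑ i,
      (2 * p i * (star (Z j i) * (Vᴴ * U) j i).re
        - (q j + t * p i) * Complex.normSq (Z j i)) := by
  obtain ⟨hU, rfl⟩ := hρ
  obtain ⟨hV, rfl⟩ := hσ
  have hU' : Uᴴ * U = 1 := mem_unitaryGroup_iff'.1 hU
  have hV' : Vᴴ * V = 1 := mem_unitaryGroup_iff'.1 hV
  have cU : ∀ M : Matrix n n ℂ, Uᴴ * (U * M) = M := fun M => by
    rw [← Matrix.mul_assoc, hU', Matrix.one_mul]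
  have cV : ∀ M : Matrix n n ℂ, Vᴴ * (V * M) = M := fun M => by
    rw [← Matrix.mul_assoc, hV', Matrix.one_mul]
  have e1 : ((V * Z * Uᴴ)ᴴ * (U * diagonal (fun i => (p i : ℂ)) * Uᴴ)).trace =
      ∑ j, ∑ i, star (Z j i) * (Vᴴ * U) j i * p i := by
    have : ((V * Z * Uᴴ)ᴴ * (U * diagonal (fun i => (p i : ℂ)) * Uᴴ)).trace =
        (Zᴴ * ((Vᴴ * U) * diagonal (fun i => (p i : ℂ)))).trace := by
      simp only [conjTranspose_mul, conjTranspose_conjTranspose, Matrix.mul_assoc]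
      rw [trace_mul_comm]
      simp only [Matrix.mul_assoc, hU', Matrix.mul_one]
    rw [this, Finset.sum_comm]
    simp only [trace, diag_apply, mul_apply (M := Zᴴ), conjTranspose_apply]
    simp only [mul_diagonal, mul_assoc]
  have e2 : ((V * diagonal (fun i => (q i : ℂ)) * Vᴴ) *
      ((V * Z * Uᴴ) * (V * Z * Uᴴ)ᴴ)).trace = ∑ j, ∑ i, q j * (Z j i * star (Z j i)) := by
    have : ((V * diagonal (fun i => (q i : ℂ)) * Vᴴ) * ((V * Z * Uᴴ) * (V * Z * Uᴴ)ᴴ)).trace =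
        (diagonal (fun i => (q i : ℂ)) * (Z * Zᴴ)).trace := by
      simp only [conjTranspose_mul, conjTranspose_conjTranspose, Matrix.mul_assoc, cU, cV]
      rw [trace_mul_comm]
      simp only [Matrix.mul_assoc, hV', Matrix.mul_one]
    rw [this]
    simp only [trace, diag_apply, diagonal_mul]
    simp only [mul_apply, conjTranspose_apply, Finset.mul_sum]
  have e3 : ((U * diagonal (fun i => (p i : ℂ)) * Uᴴ) *
      ((V * Z * Uᴴ)ᴴ * (V * Z * Uᴴ))).trace = ∑ j, ∑ i, p i * (Z j i * star (Z j i)) := by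
    have : ((U * diagonal (fun i => (p i : ℂ)) * Uᴴ) * ((V * Z * Uᴴ)ᴴ * (V * Z * Uᴴ))).trace =
        (diagonal (fun i => (p i : ℂ)) * (Zᴴ * Z)).trace := by
      simp only [conjTranspose_mul, conjTranspose_conjTranspose, Matrix.mul_assoc, cU, cV]
      rw [trace_mul_comm]
      simp only [Matrix.mul_assoc, hU', Matrix.mul_one]
    rw [this, Finset.sum_comm]
    simp only [trace, diag_apply, diagonal_mul]
    simp only [mul_apply, conjTranspose_apply, Finset.mul_sum,
      mul_comm (star _)]
  rw [quasiEntropyForm, e1, e2, e3]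
  simp only [Complex.re_sum, Finset.mul_sum, ← Finset.sum_sub_distrib]
  refine Finset.sum_congr rfl fun j _ => Finset.sum_congr rfl fun i _ => ?_
  rw [Complex.re_mul_ofReal, Complex.re_ofReal_mul, Complex.re_ofReal_mul, Complex.star_def,
    Complex.mul_conj, Complex.ofReal_re]
  ring

theorem two_mul_re_sub_le {p d : ℝ} (hd : 0 ≤ d) (h0 : d = 0 → p = 0) (z w : ℂ) :
    2 * p * (star z * w).re - d * Complex.normSq z ≤ Complex.normSq w * (p ^ 2 / d) := by
  rcases hd.eq_or_lt with rfl | hd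
  · simp [h0 rfl]
  · rw [← mul_div_assoc, le_div_iff₀ hd]
    simp only [Complex.normSq_apply, Complex.mul_re, Complex.star_def, Complex.conj_re,
      Complex.conj_im]
    nlinarith [sq_nonneg (p * w.re - d * z.re), sq_nonneg (p * w.im - d * z.im)]

theorem two_mul_re_sub_eq {p d : ℝ} (h0 : d = 0 → p = 0) (w : ℂ) :
    2 * p * (star ((p / d : ℝ) * w) * w).re - d * Complex.normSq ((p / d : ℝ) * w) =
      Complex.normSq w * (p ^ 2 / d) := by
  by_cases hd : d = 0
  · simp [hd, h0 hd]
  · simp only [Complex.normSq_apply, Complex.mul_re, Complex.mul_im, Complex.star_def,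
      Complex.conj_re, Complex.conj_im, Complex.ofReal_re, Complex.ofReal_im]
    field_simp
    ring

theorem quasiEntropyForm_le {ρ σ U V : Matrix n n ℂ} {p q : n → ℝ}
    (hρ : IsDiagonalizedBy ρ U p) (hσ : IsDiagonalizedBy σ V q) (hp : ∀ i, 0 ≤ p i)
    (hq : ∀ i, 0 ≤ q i) {t : ℝ} (ht : 0 < t) (X : Matrix n n ℂ) :
    quasiEntropyForm ρ σ t X ≤ ∑ x : n × n, Complex.normSq ((Vᴴ * U) x.1 x.2) *
      (p x.2 ^ 2 / (q x.1 + t * p x.2)) := by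
  have hX : X = V * (Vᴴ * X * U) * Uᴴ := by
    have hU' : U * Uᴴ = 1 := mem_unitaryGroup_iff.1 hρ.1
    have hV' : V * Vᴴ = 1 := mem_unitaryGroup_iff.1 hσ.1
    simp only [Matrix.mul_assoc, hU', Matrix.mul_one]
    rw [← Matrix.mul_assoc, hV', Matrix.one_mul]
  rw [hX, quasiEntropyForm_eq_sum hρ hσ, Fintype.sum_prod_type]
  refine Finset.sum_le_sum fun j _ => Finset.sum_le_sum fun i _ => ?_
  refine two_mul_re_sub_le (add_nonneg (hq j) (mul_nonneg ht.le (hp i))) (fun h => ?_) _ _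
  nlinarith [hq j, hp i, mul_nonneg ht.le (hp i)]

theorem exists_quasiEntropyForm_eq {ρ σ U V : Matrix n n ℂ} {p q : n → ℝ}
    (hρ : IsDiagonalizedBy ρ U p) (hσ : IsDiagonalizedBy σ V q) (hp : ∀ i, 0 ≤ p i)
    (hq : ∀ i, 0 ≤ q i) {t : ℝ} (ht : 0 < t) :
    ∃ X, quasiEntropyForm ρ σ t X = ∑ x : n × n, Complex.normSq ((Vᴴ * U) x.1 x.2) *
      (p x.2 ^ 2 / (q x.1 + t * p x.2)) := by
  refine ⟨V * (of fun j i => ((p i / (q j + t * p i) : ℝ) : ℂ) * (Vᴴ * U) j i) * Uᴴ, ?_⟩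
  rw [quasiEntropyForm_eq_sum hρ hσ, Fintype.sum_prod_type]
  refine Finset.sum_congr rfl fun j _ => Finset.sum_congr rfl fun i _ => ?_
  refine two_mul_re_sub_eq (fun h => ?_) _
  nlinarith [hq j, hp i, mul_nonneg ht.le (hp i)]

/-- Quasi-entropies do not increase under quantum channels. -/
theorem quasiEntropy_krausMap_le {N : κ → Matrix m n ℂ} (hN : ∑ k, (N k)ᴴ * N k = 1)
    {ρ σ U V : Matrix n n ℂ} {p q : n → ℝ} {U' V' : Matrix m m ℂ} {p' q' : m → ℝ}
    (hρ : IsDiagonalizedBy ρ U p) (hσ : IsDiagonalizedBy σ V q)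
    (hρ' : IsDiagonalizedBy (krausMap N ρ) U' p') (hσ' : IsDiagonalizedBy (krausMap N σ) V' q')
    (hρ0 : ρ.PosSemidef) (hσ0 : σ.PosSemidef)
    (hp : ∀ i, 0 ≤ p i) (hq : ∀ i, 0 ≤ q i) (hp' : ∀ i, 0 ≤ p' i) (hq' : ∀ i, 0 ≤ q' i)
    {t : ℝ} (ht : 0 < t) :
    ∑ x : m × m, Complex.normSq ((V'ᴴ * U') x.1 x.2) * (p' x.2 ^ 2 / (q' x.1 + t * p' x.2)) ≤
      ∑ x : n × n, Complex.normSq ((Vᴴ * U) x.1 x.2) * (p x.2 ^ 2 / (q x.1 + t * p x.2)) := by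
  obtain ⟨X, hX⟩ := exists_quasiEntropyForm_eq hρ' hσ' hp' hq' ht
  rw [← hX]
  exact (quasiEntropyForm_krausMap_le hN hρ0 hσ0 ht.le X).trans
    (quasiEntropyForm_le hρ hσ hp hq ht _)

end QuasiEntropy

section Entropy

variable {n : Type*} [Fintype n] [DecidableEq n]

theorem IsDiagonalizedBy.isHermitian {A U : Matrix n n ℂ} {p : n → ℝ}
    (h : IsDiagonalizedBy A U p) : A.IsHermitian := by
  rw [h.2]
  refine isHermitian_mul_mul_conjTranspose U (isHermitian_diagonal_of_self_adjoint _ ?_)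
  ext i
  simp

theorem IsDiagonalizedBy.charpoly_eq {A U : Matrix n n ℂ} {p : n → ℝ}
    (h : IsDiagonalizedBy A U p) : A.charpoly = ∏ i, (Polynomial.X - Polynomial.C (p i : ℂ)) := by
  have hU : Uᴴ * U = 1 := mem_unitaryGroup_iff'.1 h.1
  rw [h.2, charpoly_mul_comm, ← Matrix.mul_assoc, hU, Matrix.one_mul, charpoly_diagonal]

theorem IsDiagonalizedBy.vnEntropy_eq {A U : Matrix n n ℂ} {p : n → ℝ}
    (h : IsDiagonalizedBy A U p) : vnEntropy A = ∑ i, Real.negMulLog (p i) := by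
  rw [vnEntropy, dif_pos h.isHermitian]
  have h1 := h.isHermitian.roots_charpoly_eq_eigenvalues
  have h3 : (∏ i, (Polynomial.X - Polynomial.C (p i : ℂ))).roots =
      Finset.univ.val.map fun i => (p i : ℂ) := by
    rw [← Polynomial.roots_multiset_prod_X_sub_C (Finset.univ.val.map fun i => (p i : ℂ)),
      Multiset.map_map]
    rfl
  rw [h.charpoly_eq, h3] at h1
  have h2 := congrArg (fun s => (s.map fun z : ℂ => Real.negMulLog z.re).sum) h1
  simpa using h2.symm

theorem exists_isDiagonalizedBy {A : Matrix n n ℂ} (hA : A.PosSemidef) :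
    ∃ U p, IsDiagonalizedBy A U p ∧ ∀ i, 0 ≤ p i :=
  ⟨hA.1.eigenvectorUnitary, hA.1.eigenvalues, ⟨hA.1.eigenvectorUnitary.2, hA.1.spectral_theorem⟩,
    hA.eigenvalues_nonneg⟩

theorem vnEntropy_submatrix_equiv {m : Type*} [Fintype m] [DecidableEq m] (e : m ≃ n)
    {A : Matrix n n ℂ} (hA : A.PosSemidef) : vnEntropy (A.submatrix e e) = vnEntropy A := by
  obtain ⟨U, p, h, -⟩ := exists_isDiagonalizedBy hA
  have h' : IsDiagonalizedBy (A.submatrix e e) (U.submatrix e e) (p ∘ e) := by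
    refine ⟨mem_unitaryGroup_iff.2 ?_, ?_⟩
    · have hU : U * Uᴴ = 1 := mem_unitaryGroup_iff.1 h.1
      rw [star_eq_conjTranspose, conjTranspose_submatrix, submatrix_mul_equiv, hU,
        submatrix_one_equiv]
    · rw [h.2, conjTranspose_submatrix, ← submatrix_mul_equiv _ _ e e e,
        ← submatrix_mul_equiv _ _ e e e, submatrix_diagonal_equiv]
      rfl
  rw [h.vnEntropy_eq, h'.vnEntropy_eq]
  exact e.sum_comp fun i => Real.negMulLog (p i)

theorem sum_normSq_mul_eq {ρ U V : Matrix n n ℂ} {p : n → ℝ} (hρ : IsDiagonalizedBy ρ U p)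
    (j : n) : ∑ i, Complex.normSq ((Vᴴ * U) j i) * p i = ((Vᴴ * ρ * V) j j).re := by
  have : Vᴴ * ρ * V = (Vᴴ * U) * diagonal (fun i => (p i : ℂ)) * (Vᴴ * U)ᴴ := by
    rw [hρ.2]
    simp only [conjTranspose_mul, conjTranspose_conjTranspose, Matrix.mul_assoc]
  rw [this, mul_apply, Complex.re_sum]
  refine Finset.sum_congr rfl fun i _ => ?_
  rw [mul_diagonal, conjTranspose_apply, mul_right_comm, Complex.star_def, Complex.mul_conj,
    Complex.re_mul_ofReal, Complex.ofReal_re]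

theorem sum_normSq_of_mem_unitaryGroup {W : Matrix n n ℂ} (hW : W ∈ unitaryGroup n ℂ) (i : n) :
    ∑ j, Complex.normSq (W j i) = 1 := by
  have h := congrFun (congrFun (mem_unitaryGroup_iff'.1 hW) i) i
  rw [mul_apply, one_apply_eq] at h
  rw [← Complex.ofReal_inj, Complex.ofReal_one, ← h, Complex.ofReal_sum]
  exact Finset.sum_congr rfl fun j _ => Complex.normSq_eq_conj_mul_self

theorem sum_normSq_mul_prod_eq {U V : Matrix n n ℂ} (hU : U ∈ unitaryGroup n ℂ)
    (hV : V ∈ unitaryGroup n ℂ) (f : n → ℝ) :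
    ∑ x : n × n, Complex.normSq ((Vᴴ * U) x.1 x.2) * f x.2 = ∑ i, f i := by
  rw [Fintype.sum_prod_type, Finset.sum_comm]
  refine Finset.sum_congr rfl fun i _ => ?_
  have h := sum_normSq_of_mem_unitaryGroup (mul_mem (Unitary.star_mem hV) hU) i
  rw [star_eq_conjTranspose] at h
  dsimp only
  rw [← Finset.sum_mul, h, one_mul]

theorem IsDiagonalizedBy.trace_eq {A U : Matrix n n ℂ} {p : n → ℝ}
    (h : IsDiagonalizedBy A U p) : A.trace.re = ∑ i, p i := by
  have hU : Uᴴ * U = 1 := mem_unitaryGroup_iff'.1 h.1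
  rw [h.2, trace_mul_comm, ← Matrix.mul_assoc, hU, Matrix.one_mul, trace_diagonal, Complex.re_sum]
  simp

end Entropy

section PartialTrace

variable {α α' β β' γ κ : Type*}

/-- The partial trace over the first tensor factor. -/
def traceLeft [Fintype α] (ρ : Matrix (α × β) (α × β') ℂ) : Matrix β β' ℂ :=
  fun y y' => ∑ x, ρ (x, y) (x, y')

theorem traceLeft_eq_sum_submatrix [Fintype α] (ρ : Matrix (α × β) (α × β') ℂ) :
    traceLeft ρ = ∑ x, ρ.submatrix (Prod.mk x) (Prod.mk x) := by
  ext y y'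
  simp [traceLeft, Matrix.sum_apply]

theorem traceLeft_apply_eq_trace [Fintype α] (ρ : Matrix (α × β) (α × β') ℂ) (y : β) (y' : β') :
    traceLeft ρ y y' = (ρ.submatrix (fun x => (x, y)) fun x => (x, y')).trace := rfl

theorem traceLeft_sum [Fintype α] (s : Finset κ) (f : κ → Matrix (α × β) (α × β') ℂ) :
    traceLeft (∑ k ∈ s, f k) = ∑ k ∈ s, traceLeft (f k) := by
  ext y y'
  simp only [traceLeft, Matrix.sum_apply]
  rw [Finset.sum_comm]

theorem traceLeft_posSemidef [Fintype α] [Fintype β] {ρ : Matrix (α × β) (α × β) ℂ}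
    (hρ : ρ.PosSemidef) : (traceLeft ρ).PosSemidef := by
  rw [traceLeft_eq_sum_submatrix]
  exact posSemidef_sum _ fun x _ => hρ.submatrix _

theorem one_kronecker_mul_mul_apply [Fintype α] [DecidableEq α] [Fintype β] [Fintype β']
    (M : Matrix γ β ℂ) (ρ : Matrix (α × β) (α × β') ℂ) (N : Matrix β' κ ℂ) (x x' : α)
    (y : γ) (y' : κ) :
    (((1 : Matrix α α ℂ) ⊗ₖ M) * ρ * ((1 : Matrix α α ℂ) ⊗ₖ N)) (x, y) (x', y') =
      (M * ρ.submatrix (Prod.mk x) (Prod.mk x') * N) y y' := by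
  simp [mul_apply, Fintype.sum_prod_type, one_apply, ite_mul, Finset.sum_mul]

theorem traceLeft_one_kronecker_mul_mul [Fintype α] [DecidableEq α] [Fintype β] [Fintype β']
    (M : Matrix γ β ℂ) (ρ : Matrix (α × β) (α × β') ℂ) (N : Matrix β' κ ℂ) :
    traceLeft (((1 : Matrix α α ℂ) ⊗ₖ M) * ρ * ((1 : Matrix α α ℂ) ⊗ₖ N)) =
      M * traceLeft ρ * N := by
  rw [traceLeft_eq_sum_submatrix ρ, Matrix.mul_sum, Matrix.sum_mul]
  ext y y'
  simp only [traceLeft, one_kronecker_mul_mul_apply, Matrix.sum_apply]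

theorem traceLeft_krausMap_kronecker_one [Fintype α] [DecidableEq α] [Fintype α'] [Fintype β]
    [DecidableEq β] [Fintype κ] {K : κ → Matrix α' α ℂ} (hK : ∑ k, (K k)ᴴ * K k = 1)
    (ρ : Matrix (α × β) (α × β) ℂ) :
    traceLeft (krausMap (fun k => K k ⊗ₖ (1 : Matrix β β ℂ)) ρ) = traceLeft ρ := by
  ext y y'
  rw [traceLeft_apply_eq_trace, traceLeft_apply_eq_trace, ← trace_krausMap hK]
  congr 1
  ext x x'
  simp only [submatrix_apply, krausMap, Matrix.sum_apply]
  simp [mul_apply, Fintype.sum_prod_type, one_apply, Finset.sum_mul, apply_ite]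

end PartialTrace

section KroneckerSum

variable {α α' β β' κ : Type*}

theorem kronecker_sum (s : Finset κ) (A : Matrix α α' ℂ) (B : κ → Matrix β β' ℂ) :
    A ⊗ₖ (∑ k ∈ s, B k) = ∑ k ∈ s, A ⊗ₖ B k := by
  ext x y
  simp [Matrix.sum_apply, Finset.mul_sum]

theorem sum_kronecker (s : Finset κ) (A : κ → Matrix α α' ℂ) (B : Matrix β β' ℂ) :
    (∑ k ∈ s, A k) ⊗ₖ B = ∑ k ∈ s, A k ⊗ₖ B := by
  ext x y
  simp [Matrix.sum_apply, Finset.sum_mul]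

end KroneckerSum

section DataProcessing

variable {α β γ κ : Type*} [Fintype α] [DecidableEq α] [Fintype β] [DecidableEq β] [Fintype γ]
  [DecidableEq γ] [Fintype κ]

theorem IsDiagonalizedBy.one_kronecker {A U : Matrix β β ℂ} {p : β → ℝ}
    (h : IsDiagonalizedBy A U p) :
    IsDiagonalizedBy ((1 : Matrix α α ℂ) ⊗ₖ A) ((1 : Matrix α α ℂ) ⊗ₖ U) fun x => p x.2 := by
  refine ⟨kronecker_mem_unitary (one_mem _) h.1, ?_⟩
  rw [h.2, conjTranspose_kronecker, conjTranspose_one,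
    show diagonal (fun x : α × β => (p x.2 : ℂ)) =
      (1 : Matrix α α ℂ) ⊗ₖ diagonal (fun y => (p y : ℂ)) by
      rw [← diagonal_one, diagonal_kronecker_diagonal]; simp,
    ← mul_kronecker_mul, ← mul_kronecker_mul, Matrix.one_mul, Matrix.one_mul]

section Marginal

variable {ρ U : Matrix (α × β) (α × β) ℂ} {p : α × β → ℝ} {W : Matrix β β ℂ} {q : β → ℝ}

theorem sum_sum_normSq_mul_eq_marginal (hρ : IsDiagonalizedBy ρ U p)
    (hω : IsDiagonalizedBy (traceLeft ρ) W q) (y : β) :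
    ∑ x, ∑ i, Complex.normSq ((((1 : Matrix α α ℂ) ⊗ₖ W)ᴴ * U) (x, y) i) * p i = q y := by
  have hW : Wᴴ * W = 1 := mem_unitaryGroup_iff'.1 hω.1
  have h : (Wᴴ * traceLeft ρ * W) y y = q y := by
    rw [hω.2]
    simp only [Matrix.mul_assoc, hW, Matrix.mul_one]
    rw [← Matrix.mul_assoc, hW, Matrix.one_mul, diagonal_apply_eq]
  simp only [sum_normSq_mul_eq hρ]
  rw [← Complex.ofReal_re (q y), ← h, ← traceLeft_one_kronecker_mul_mul, ← Complex.re_sum,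
    conjTranspose_kronecker, conjTranspose_one]
  rfl

theorem normSq_mul_eq_zero_of_marginal_eq_zero (hρ : IsDiagonalizedBy ρ U p) (hp : ∀ i, 0 ≤ p i)
    (hω : IsDiagonalizedBy (traceLeft ρ) W q) (z : (α × β) × (α × β)) (hz : q z.1.2 = 0) :
    Complex.normSq ((((1 : Matrix α α ℂ) ⊗ₖ W)ᴴ * U) z.1 z.2) * p z.2 = 0 := by
  have h := sum_sum_normSq_mul_eq_marginal hρ hω z.1.2
  have h0 : ∀ x i, 0 ≤ Complex.normSq ((((1 : Matrix α α ℂ) ⊗ₖ W)ᴴ * U) (x, z.1.2) i) * p i :=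
    fun x i => mul_nonneg (Complex.normSq_nonneg _) (hp i)
  rw [hz, Finset.sum_eq_zero_iff_of_nonneg fun x _ => Finset.sum_nonneg fun i _ => h0 x i] at h
  have h1 := h z.1.1 (Finset.mem_univ _)
  rw [Finset.sum_eq_zero_iff_of_nonneg fun i _ => h0 _ i] at h1
  exact h1 z.2 (Finset.mem_univ _)

/-- The relative entropy of `ρ` with respect to `1 ⊗ traceLeft ρ` is a conditional entropy. -/
theorem sum_normSq_mul_log_sub_log_eq (hρ : IsDiagonalizedBy ρ U p)
    (hω : IsDiagonalizedBy (traceLeft ρ) W q) :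
    ∑ z : (α × β) × (α × β), Complex.normSq ((((1 : Matrix α α ℂ) ⊗ₖ W)ᴴ * U) z.1 z.2) * p z.2 *
      (Real.log (p z.2) - Real.log (q z.1.2)) = vnEntropy (traceLeft ρ) - vnEntropy ρ := by
  simp only [mul_sub, Finset.sum_sub_distrib]
  have h1 : ∑ z : (α × β) × (α × β), Complex.normSq ((((1 : Matrix α α ℂ) ⊗ₖ W)ᴴ * U) z.1 z.2) *
      p z.2 * Real.log (p z.2) = - vnEntropy ρ := by
    simp only [mul_assoc]
    rw [sum_normSq_mul_prod_eq hρ.1 hω.one_kronecker.1 fun i => p i * Real.log (p i),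
      hρ.vnEntropy_eq, ← Finset.sum_neg_distrib]
    simp [Real.negMulLog]
  have h2 : ∑ z : (α × β) × (α × β), Complex.normSq ((((1 : Matrix α α ℂ) ⊗ₖ W)ᴴ * U) z.1 z.2) *
      p z.2 * Real.log (q z.1.2) = - vnEntropy (traceLeft ρ) := by
    rw [hω.vnEntropy_eq, ← Finset.sum_neg_distrib, Fintype.sum_prod_type, Fintype.sum_prod_type,
      Finset.sum_comm]
    refine Finset.sum_congr rfl fun y _ => ?_
    dsimp only
    simp only [← Finset.sum_mul]
    rw [sum_sum_normSq_mul_eq_marginal hρ hω, Real.negMulLog]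
    ring
  rw [h1, h2]
  ring

end Marginal

omit [DecidableEq β] [Fintype γ] [DecidableEq γ] in
theorem krausMap_one_kronecker (M : κ → Matrix γ β ℂ) (ω : Matrix β β ℂ) :
    krausMap (fun k => (1 : Matrix α α ℂ) ⊗ₖ M k) ((1 : Matrix α α ℂ) ⊗ₖ ω) =
      (1 : Matrix α α ℂ) ⊗ₖ krausMap M ω := by
  simp only [krausMap, conjTranspose_kronecker, conjTranspose_one, ← mul_kronecker_mul,
    Matrix.one_mul, kronecker_sum]

omit [DecidableEq β] [Fintype γ] [DecidableEq γ] in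
theorem traceLeft_krausMap_one_kronecker (M : κ → Matrix γ β ℂ) (ρ : Matrix (α × β) (α × β) ℂ) :
    traceLeft (krausMap (fun k => (1 : Matrix α α ℂ) ⊗ₖ M k) ρ) = krausMap M (traceLeft ρ) := by
  simp only [krausMap, traceLeft_sum, conjTranspose_kronecker, conjTranspose_one,
    traceLeft_one_kronecker_mul_mul]

/-- The conditional entropy does not decrease under a channel on the conditioning system. -/
theorem vnEntropy_traceLeft_sub_le {M : κ → Matrix γ β ℂ} (hM : ∑ k, (M k)ᴴ * M k = 1)
    {ρ : Matrix (α × β) (α × β) ℂ} (hρ : ρ.PosSemidef) :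
    vnEntropy (traceLeft (krausMap (fun k => (1 : Matrix α α ℂ) ⊗ₖ M k) ρ)) -
        vnEntropy (krausMap (fun k => (1 : Matrix α α ℂ) ⊗ₖ M k) ρ) ≤
      vnEntropy (traceLeft ρ) - vnEntropy ρ := by
  set N := fun k => (1 : Matrix α α ℂ) ⊗ₖ M k with hN
  have hN1 : ∑ k, (N k)ᴴ * N k = 1 := by
    simp only [hN, conjTranspose_kronecker, conjTranspose_one, ← mul_kronecker_mul, Matrix.one_mul]
    rw [← one_kronecker_one, ← hM, kronecker_sum]
  have hτ := krausMap_posSemidef N hρ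
  obtain ⟨U, p, hU, hp⟩ := exists_isDiagonalizedBy hρ
  obtain ⟨W, q, hW, hq⟩ := exists_isDiagonalizedBy (traceLeft_posSemidef hρ)
  obtain ⟨U', p', hU', hp'⟩ := exists_isDiagonalizedBy hτ
  obtain ⟨W', q', hW', hq'⟩ := exists_isDiagonalizedBy (traceLeft_posSemidef hτ)
  rw [← sum_normSq_mul_log_sub_log_eq hU hW, ← sum_normSq_mul_log_sub_log_eq hU' hW']
  have hσ' : IsDiagonalizedBy (krausMap N ((1 : Matrix α α ℂ) ⊗ₖ traceLeft ρ))
      ((1 : Matrix α α ℂ) ⊗ₖ W') fun x => q' x.2 := by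
    rw [krausMap_one_kronecker, ← traceLeft_krausMap_one_kronecker]
    exact hW'.one_kronecker
  refine sum_mul_log_le_of_quasi_le (fun z => hp z.2) (fun z => hq z.1.2) (fun z => hp' z.2)
    (fun z => hq' z.1.2) (normSq_mul_eq_zero_of_marginal_eq_zero hU hp hW)
    (normSq_mul_eq_zero_of_marginal_eq_zero hU' hp' hW') ?_ fun t ht => ?_
  · rw [sum_normSq_mul_prod_eq hU.1 hW.one_kronecker.1 p,
      sum_normSq_mul_prod_eq hU'.1 hW'.one_kronecker.1 p', ← hU.trace_eq, ← hU'.trace_eq,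
      trace_krausMap hN1]
  · exact quasiEntropy_krausMap_le hN1 hU hW.one_kronecker hU' hσ' hρ
      (PosSemidef.one.kronecker (traceLeft_posSemidef hρ)) hp (fun x => hq x.2) hp'
      (fun x => hq' x.2) ht

end DataProcessing

section CondMutualInfo

variable {α α' β β' γ κ : Type*} [Fintype α] [DecidableEq α] [Fintype β] [DecidableEq β]
  [Fintype α'] [DecidableEq α'] [Fintype β'] [DecidableEq β'] [Fintype γ] [DecidableEq γ]
  [Fintype κ]

/-- Exchange of the first two factors of a triple product. -/
def swapFst (α β γ : Type*) : α × β × γ ≃ β × α × γ where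
  toFun x := (x.2.1, x.1, x.2.2)
  invFun x := (x.2.1, x.1, x.2.2)
  left_inv _ := rfl
  right_inv _ := rfl

theorem condMutualInfo_submatrix_swapFst {ρ : Matrix (α × β × γ) (α × β × γ) ℂ}
    (hρ : ρ.PosSemidef) :
    condMutualInfo (ρ.submatrix (swapFst β α γ) (swapFst β α γ)) = condMutualInfo ρ := by
  have hC : reduceC (ρ.submatrix (swapFst β α γ) (swapFst β α γ)) = reduceC ρ := by
    ext c c'
    exact Finset.sum_comm
  simp only [condMutualInfo, hC, vnEntropy_submatrix_equiv _ hρ]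
  change vnEntropy (reduceBC ρ) + vnEntropy (reduceAC ρ) - _ - _ = _
  ring

omit [DecidableEq α] [DecidableEq β] [Fintype α'] [DecidableEq α'] [Fintype β']
  [DecidableEq β'] in
theorem krausMap_submatrix_swapFst (K : κ → Matrix α' α ℂ) (L : κ → Matrix β' β ℂ)
    (ρ : Matrix (α × β × γ) (α × β × γ) ℂ) :
    (krausMap (fun k => K k ⊗ₖ (L k ⊗ₖ (1 : Matrix γ γ ℂ))) ρ).submatrix
        (swapFst β' α' γ) (swapFst β' α' γ) =
      krausMap (fun k => L k ⊗ₖ (K k ⊗ₖ (1 : Matrix γ γ ℂ)))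
        (ρ.submatrix (swapFst β α γ) (swapFst β α γ)) := by
  have h : ∀ k, (K k ⊗ₖ (L k ⊗ₖ (1 : Matrix γ γ ℂ))).submatrix (swapFst β' α' γ) (swapFst β α γ) =
      L k ⊗ₖ (K k ⊗ₖ (1 : Matrix γ γ ℂ)) := by
    intro k
    ext x y
    simp [swapFst, mul_left_comm]
  simp only [krausMap, ← h, conjTranspose_submatrix, submatrix_mul_equiv]
  ext x y
  simp [Matrix.sum_apply]

/-- A channel on the second system does not increase the conditional mutual information. -/
theorem condMutualInfo_krausMap_snd_le {L : κ → Matrix β' β ℂ} (hL : ∑ k, (L k)ᴴ * L k = 1)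
    {ρ : Matrix (α × β × γ) (α × β × γ) ℂ} (hρ : ρ.PosSemidef) :
    condMutualInfo (krausMap (fun k => (1 : Matrix α α ℂ) ⊗ₖ (L k ⊗ₖ (1 : Matrix γ γ ℂ))) ρ) ≤
      condMutualInfo ρ := by
  set τ := krausMap (fun k => (1 : Matrix α α ℂ) ⊗ₖ (L k ⊗ₖ (1 : Matrix γ γ ℂ))) ρ with hτ
  have hAC : reduceAC τ = reduceAC ρ := by
    change traceLeft (τ.submatrix (swapFst β' α γ) (swapFst β' α γ)) =
      traceLeft (ρ.submatrix (swapFst β α γ) (swapFst β α γ))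
    rw [hτ, krausMap_submatrix_swapFst]
    simp only [one_kronecker_one]
    exact traceLeft_krausMap_kronecker_one hL _
  have hC : reduceC τ = reduceC ρ := congrArg traceLeft hAC
  have hM : ∑ k, (L k ⊗ₖ (1 : Matrix γ γ ℂ))ᴴ * (L k ⊗ₖ (1 : Matrix γ γ ℂ)) = 1 := by
    simp only [conjTranspose_kronecker, conjTranspose_one, ← mul_kronecker_mul, Matrix.one_mul]
    rw [← one_kronecker_one, ← hL, sum_kronecker]
  have h : vnEntropy (reduceBC τ) - vnEntropy τ ≤ vnEntropy (reduceBC ρ) - vnEntropy ρ :=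
    vnEntropy_traceLeft_sub_le hM hρ
  rw [condMutualInfo, condMutualInfo, hAC, hC]
  linarith

/-- A channel on the first system does not increase the conditional mutual information. -/
theorem condMutualInfo_krausMap_fst_le {K : κ → Matrix α' α ℂ} (hK : ∑ k, (K k)ᴴ * K k = 1)
    {ρ : Matrix (α × β × γ) (α × β × γ) ℂ} (hρ : ρ.PosSemidef) :
    condMutualInfo (krausMap (fun k => K k ⊗ₖ ((1 : Matrix β β ℂ) ⊗ₖ (1 : Matrix γ γ ℂ))) ρ) ≤
      condMutualInfo ρ := by
  rw [← condMutualInfo_submatrix_swapFst hρ,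
    ← condMutualInfo_submatrix_swapFst (krausMap_posSemidef _ hρ), krausMap_submatrix_swapFst]
  exact condMutualInfo_krausMap_snd_le hK (hρ.submatrix _)

end CondMutualInfo

/-- Conditional quantum data processing inequality: local channels acting on `A` and `B`
(leaving `C` unchanged) do not increase the conditional quantum mutual information. -/
theorem stmt4 {ιA ιB ιC ιA' ιB' ιK ιL : Type*}
    [Fintype ιA] [DecidableEq ιA] [Fintype ιB] [DecidableEq ιB]
    [Fintype ιC] [DecidableEq ιC]
    [Fintype ιA'] [DecidableEq ιA'] [Fintype ιB'] [DecidableEq ιB']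
    [Fintype ιK] [Fintype ιL]
    (ρ : Matrix (ιA × ιB × ιC) (ιA × ιB × ιC) ℂ) (hρ : IsDensityMatrix ρ)
    (K : ιK → Matrix ιA' ιA ℂ) (hK : ∑ i, (K i)ᴴ * K i = 1)
    (L : ιL → Matrix ιB' ιB ℂ) (hL : ∑ j, (L j)ᴴ * L j = 1)
    (σ : Matrix (ιA' × ιB' × ιC) (ιA' × ιB' × ιC) ℂ)
    (hσ : σ = ∑ i, ∑ j,
      (K i ⊗ₖ (L j ⊗ₖ (1 : Matrix ιC ιC ℂ))) * ρ * (K i ⊗ₖ (L j ⊗ₖ (1 : Matrix ιC ιC ℂ)))ᴴ) :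
    condMutualInfo σ ≤ condMutualInfo ρ := by
  have h : σ = krausMap (fun i => K i ⊗ₖ ((1 : Matrix ιB' ιB' ℂ) ⊗ₖ (1 : Matrix ιC ιC ℂ)))
      (krausMap (fun j => (1 : Matrix ιA ιA ℂ) ⊗ₖ (L j ⊗ₖ (1 : Matrix ιC ιC ℂ))) ρ) := by
    have hKL : ∀ i j, K i ⊗ₖ (L j ⊗ₖ (1 : Matrix ιC ιC ℂ)) =
        (K i ⊗ₖ ((1 : Matrix ιB' ιB' ℂ) ⊗ₖ (1 : Matrix ιC ιC ℂ))) *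
          ((1 : Matrix ιA ιA ℂ) ⊗ₖ (L j ⊗ₖ (1 : Matrix ιC ιC ℂ))) := by
      intro i j
      rw [← mul_kronecker_mul, ← mul_kronecker_mul, Matrix.mul_one, Matrix.one_mul, Matrix.one_mul]
    simp only [hσ, krausMap, Matrix.mul_sum, Matrix.sum_mul, hKL, conjTranspose_mul,
      Matrix.mul_assoc]
  rw [h]
  exact (condMutualInfo_krausMap_fst_le hK (krausMap_posSemidef _ hρ.1)).trans
    (condMutualInfo_krausMap_snd_le hL hρ.1)
end
end

section
/- (Superadditivity of entropy gain II.) Let D ≥ 1 and let ι_A, ι_{A'}, ι_R, ι be finite types. For each d ∈ Fin D let φ_d be a quantum channel from matrices on ℂ^{ι_A} to matrices on ℂ^{ι_{A'}}, given by Kraus operators K_{d,i} ∈ Matrix ι_{A'} ι_A ℂ, i ∈ ι, with ∑_i K_{d,i}ᴴ K_{d,i} = 1. Let ρ be a density matrix on the index type (Fin D → ι_A) × ι_R, and for each d let ρ_{d,R} be its reduced density matrix on the pair (A_d, R), obtained by partial trace over all A-factors other than the d-th. Let (⊗_d φ_d) ⊗ id_R be the channel that applies φ_d on each factor A_d and leaves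 R unchanged. Then S(((⊗_d φ_d) ⊗ id_R)(ρ)) − S(ρ) ≥ ∑_{d} [S((φ_d ⊗ id_R)(ρ_{d,R})) − S(ρ_{d,R})]. -/
open Matrix Kronecker BigOperators ComplexOrder

noncomputable section

/-- Kraus operators of `(⊗_d φ_d) ⊗ id_R`: the tensor product of the Kraus operators of
the channels `φ_d` on the factors `A_d`, tensored with the identity on `R`. -/
noncomputable def tensorKrausR {D : ℕ} {ιA ιA' ιR ι : Type*} [Fintype ιR] [DecidableEq ιR]
    (K : Fin D → ι → Matrix ιA' ιA ℂ) (i : Fin D → ι) :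
    Matrix ((Fin D → ιA') × ιR) ((Fin D → ιA) × ιR) ℂ :=
  (fun f g => ∏ d, K d (i d) (f d) (g d) :
    Matrix (Fin D → ιA') (Fin D → ιA) ℂ) ⊗ₖ (1 : Matrix ιR ιR ℂ)

/-- Kraus operators of `φ ⊗ id_R`. -/
noncomputable def krausIdR {ιA ιA' ιR ι : Type*} [Fintype ιR] [DecidableEq ιR]
    (K : ι → Matrix ιA' ιA ℂ) (i : ι) : Matrix (ιA' × ιR) (ιA × ιR) ℂ :=
  K i ⊗ₖ (1 : Matrix ιR ιR ℂ)

/-- The reduced density matrix on the pair `(A_d, R)`, obtained by partial trace over all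
`A`-factors other than the `d`-th. -/
noncomputable def reduceAR {D : ℕ} {ιA ιR : Type*} [Fintype ιA] [DecidableEq ιA]
    (ρ : Matrix ((Fin D → ιA) × ιR) ((Fin D → ιA) × ιR) ℂ) (d : Fin D) :
    Matrix (ιA × ιR) (ιA × ιR) ℂ :=
  fun p q => ∑ f : Fin D → ιA,
    if f d = q.1 then ρ (Function.update f d p.1, p.2) (f, q.2) else 0

/-- The data of a classical transition `p ↦ q` with transition weights `w`, as obtained from a
quantum channel by diagonalizing its input and its output. -/
structure IsTransition {ι κ : Type*} [Fintype ι] [Fintype κ]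
    (p : ι → ℝ) (q : κ → ℝ) (w : κ → ι → ℝ) : Prop where
  p_nonneg : ∀ a, 0 ≤ p a
  w_nonneg : ∀ b a, 0 ≤ w b a
  sum_w : ∀ a, ∑ b, w b a = 1
  q_eq : ∀ b, q b = ∑ a, w b a * p a

namespace IsTransition

variable {ι κ ι' κ' : Type*} [Fintype ι] [Fintype κ] [Fintype ι'] [Fintype κ']
  {p : ι → ℝ} {q : κ → ℝ} {w : κ → ι → ℝ} {p' : ι' → ℝ} {q' : κ' → ℝ} {w' : κ' → ι' → ℝ}

lemma q_nonneg (h : IsTransition p q w) (b : κ) : 0 ≤ q b := by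
  rw [h.q_eq]
  exact Finset.sum_nonneg fun a _ => mul_nonneg (h.w_nonneg b a) (h.p_nonneg a)

lemma pos_of_mul_ne_zero (h : IsTransition p q w) {b : κ} {a : ι} (hne : w b a * p a ≠ 0) :
    0 < q b ∧ 0 < p a := by
  have hpos : ∀ a, 0 ≤ w b a * p a := fun a => mul_nonneg (h.w_nonneg b a) (h.p_nonneg a)
  refine ⟨?_, lt_of_le_of_ne (h.p_nonneg a) fun h0 => hne (by rw [← h0, mul_zero])⟩
  rw [h.q_eq]
  exact ((hpos a).lt_of_ne' hne).trans_le
    (Finset.single_le_sum (fun a _ => hpos a) (Finset.mem_univ a))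

lemma sum_negMulLog_sub (h : IsTransition p q w) :
    ∑ b, Real.negMulLog (q b) - ∑ a, Real.negMulLog (p a) =
      ∑ b, ∑ a, w b a * p a * (Real.log (p a) - Real.log (q b)) := by
  simp only [mul_sub, Finset.sum_sub_distrib]
  have h1 : ∑ b, ∑ a, w b a * p a * Real.log (p a) = -∑ a, Real.negMulLog (p a) := by
    rw [Finset.sum_comm, ← Finset.sum_neg_distrib]
    refine Finset.sum_congr rfl fun a _ => ?_
    simp_rw [mul_assoc]
    rw [← Finset.sum_mul, h.sum_w, one_mul, Real.negMulLog]
    ring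
  have h2 : ∑ b, ∑ a, w b a * p a * Real.log (q b) = -∑ b, Real.negMulLog (q b) := by
    rw [← Finset.sum_neg_distrib]
    refine Finset.sum_congr rfl fun b _ => ?_
    rw [← Finset.sum_mul, ← h.q_eq, Real.negMulLog]
    ring
  rw [h1, h2]
  ring

lemma tendsto_sum_log (h : IsTransition p q w) :
    Filter.Tendsto (fun T : ℝ => ∑ b, ∑ a, w b a * p a * (Real.log (q b + T * p a) - Real.log (q b))
        - (∑ a, p a) * Real.log T) Filter.atTop
      (nhds (∑ b, Real.negMulLog (q b) - ∑ a, Real.negMulLog (p a))) := by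
  have hsum : ∑ a, p a = ∑ b, ∑ a, w b a * p a := by
    rw [Finset.sum_comm]
    exact Finset.sum_congr rfl fun a _ => by rw [← Finset.sum_mul, h.sum_w, one_mul]
  rw [h.sum_negMulLog_sub]
  simp_rw [hsum, Finset.sum_mul, ← Finset.sum_sub_distrib, ← mul_sub]
  refine tendsto_finsetSum _ fun b _ => tendsto_finsetSum _ fun a _ => ?_
  by_cases hne : w b a * p a = 0
  · simp [hne]
  obtain ⟨hq, hp⟩ := h.pos_of_mul_ne_zero hne
  refine Filter.Tendsto.const_mul _ ?_
  have hlim : Filter.Tendsto (fun T : ℝ => q b / T + p a) Filter.atTop (nhds (p a)) := by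
    simpa using (Filter.Tendsto.const_div_atTop Filter.tendsto_id (q b)).add_const (p a)
  refine ((hlim.log hp.ne').sub_const (Real.log (q b))).congr' ?_
  filter_upwards [Filter.eventually_gt_atTop 0] with T hT
  have : q b + T * p a = (q b / T + p a) * T := by field_simp
  rw [this, Real.log_mul (by positivity) hT.ne']
  ring

lemma hasDerivAt_sum_log (h : IsTransition p q w) {T : ℝ} (hT : 0 ≤ T) :
    HasDerivAt (fun T : ℝ => ∑ b, ∑ a, w b a * p a * (Real.log (q b + T * p a) - Real.log (q b)))
      (∑ b, ∑ a, w b a * p a * (p a / (q b + T * p a))) T := by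
  refine HasDerivAt.fun_sum fun b _ => HasDerivAt.fun_sum fun a _ => ?_
  by_cases hne : w b a * p a = 0
  · simpa [hne] using hasDerivAt_const T (0 : ℝ)
  obtain ⟨hq, hp⟩ := h.pos_of_mul_ne_zero hne
  have h1 : HasDerivAt (fun T : ℝ => q b + T * p a) (p a) T := by
    simpa using ((hasDerivAt_id T).mul_const (p a)).const_add (q b)
  exact ((h1.log (by positivity)).sub_const _).const_mul _

/-- The entropy gain is monotone in the resolvent quadratic forms: this is the integral
representation of the logarithm. -/
lemma sum_negMulLog_sub_le (h : IsTransition p q w) (h' : IsTransition p' q' w')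
    (hsum : ∑ a, p a = ∑ a, p' a)
    (hle : ∀ t : ℝ, 0 < t → ∑ b, ∑ a, w b a * p a * (p a / (q b + t * p a)) ≤
      ∑ b, ∑ a, w' b a * p' a * (p' a / (q' b + t * p' a))) :
    ∑ b, Real.negMulLog (q b) - ∑ a, Real.negMulLog (p a) ≤
      ∑ b, Real.negMulLog (q' b) - ∑ a, Real.negMulLog (p' a) := by
  refine le_of_tendsto_of_tendsto h.tendsto_sum_log h'.tendsto_sum_log ?_
  have hmono : MonotoneOn (fun T : ℝ =>
      ∑ b, ∑ a, w' b a * p' a * (Real.log (q' b + T * p' a) - Real.log (q' b)) -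
      ∑ b, ∑ a, w b a * p a * (Real.log (q b + T * p a) - Real.log (q b))) (Set.Ici 0) := by
    have hd : ∀ T : ℝ, 0 ≤ T → HasDerivAt (fun T : ℝ =>
        ∑ b, ∑ a, w' b a * p' a * (Real.log (q' b + T * p' a) - Real.log (q' b)) -
        ∑ b, ∑ a, w b a * p a * (Real.log (q b + T * p a) - Real.log (q b))) _ T :=
      fun T hT => (h'.hasDerivAt_sum_log hT).sub (h.hasDerivAt_sum_log hT)
    refine monotoneOn_of_deriv_nonneg (convex_Ici 0)
      (fun T hT => (hd T hT).continuousAt.continuousWithinAt) ?_ ?_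
    · intro T hT
      rw [interior_Ici] at hT
      exact (hd T (le_of_lt hT)).differentiableAt.differentiableWithinAt
    · intro T hT
      rw [interior_Ici] at hT
      rw [(hd T (le_of_lt hT)).deriv]
      exact sub_nonneg.2 (hle T hT)
  filter_upwards [Filter.eventually_ge_atTop 0] with T hT
  have := hmono Set.self_mem_Ici hT hT
  simp only [zero_mul, add_zero, sub_self, mul_zero, Finset.sum_const_zero] at this
  rw [hsum]
  linarith

end IsTransition

/-- The concave quadratic functional whose supremum over `Y` is the resolvent form
`⟨ρ, (L + t R)⁻¹ ρ⟩` of a channel. -/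
noncomputable def krausForm {ι κ X : Type*} [Fintype ι] [Fintype κ] [Fintype X]
    (K : X → Matrix κ ι ℂ) (ρ : Matrix ι ι ℂ) (t : ℝ) (Y : X → Matrix κ ι ℂ) : ℝ :=
  ∑ x, (2 * ((Y x)ᴴ * K x * ρ).trace.re - ((Y x)ᴴ * chanApply K ρ * Y x).trace.re -
    t * ((Y x)ᴴ * Y x * ρ).trace.re)

section Spectral

variable {ι κ X : Type*} [Fintype ι] [DecidableEq ι] [Fintype κ] [DecidableEq κ] [Fintype X]

lemma vnEntropy_eq {ρ : Matrix ι ι ℂ} (h : ρ.IsHermitian) :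
    vnEntropy ρ = ∑ i, Real.negMulLog (h.eigenvalues i) := by
  rw [vnEntropy, dif_pos h]

lemma vnEntropy_submatrix (ρ : Matrix ι ι ℂ) (e : κ ≃ ι) :
    vnEntropy (ρ.submatrix e e) = vnEntropy ρ := by
  by_cases h : ρ.IsHermitian
  · have h' : (ρ.submatrix e e).IsHermitian := h.submatrix e
    have key := (h'.roots_charpoly_eq_eigenvalues).symm.trans
      ((congrArg Polynomial.roots (Matrix.charpoly_reindex e.symm ρ)).trans
        h.roots_charpoly_eq_eigenvalues)
    have := congrArg (fun s : Multiset ℂ => (s.map fun z => Real.negMulLog z.re).sum) key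
    rw [Multiset.map_map, Multiset.map_map] at this
    rw [vnEntropy_eq h, vnEntropy_eq h']
    exact this
  · have h' : ¬(ρ.submatrix e e).IsHermitian := fun h' => h (by
      simpa using h'.submatrix e.symm)
    rw [vnEntropy, vnEntropy, dif_neg h, dif_neg h']

omit [DecidableEq ι] [DecidableEq κ] in
lemma posSemidef_chanApply (K : X → Matrix κ ι ℂ) {ρ : Matrix ι ι ℂ} (hρ : ρ.PosSemidef) :
    (chanApply K ρ).PosSemidef :=
  Matrix.posSemidef_sum _ fun x _ => hρ.mul_mul_conjTranspose_same (K x)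

lemma exists_unitary_diagonal {ρ : Matrix ι ι ℂ} (h : ρ.IsHermitian) :
    ∃ U : Matrix ι ι ℂ, Uᴴ * U = 1 ∧ U * Uᴴ = 1 ∧
      ρ = U * diagonal (fun i => (h.eigenvalues i : ℂ)) * Uᴴ := by
  refine ⟨h.eigenvectorUnitary, Unitary.coe_star_mul_self _, Unitary.coe_mul_star_self _, ?_⟩
  exact h.spectral_theorem

omit [DecidableEq κ] in
lemma re_trace_conjTranspose_mul_mul_diagonal (Z M : Matrix κ ι ℂ) (p : ι → ℝ) :
    (Zᴴ * M * diagonal (fun a => (p a : ℂ))).trace.re =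
      ∑ b, ∑ a, (star (Z b a) * M b a).re * p a := by
  rw [Finset.sum_comm]
  simp only [Matrix.trace, Matrix.diag_apply, Matrix.mul_diagonal, Complex.re_sum,
    Complex.re_mul_ofReal]
  refine Finset.sum_congr rfl fun a _ => ?_
  rw [Matrix.mul_apply, Complex.re_sum, Finset.sum_mul]
  rfl

omit [DecidableEq ι] in
lemma re_trace_conjTranspose_mul_diagonal_mul (Z : Matrix κ ι ℂ) (q : κ → ℝ) :
    (Zᴴ * diagonal (fun b => (q b : ℂ)) * Z).trace.re =
      ∑ b, ∑ a, ‖Z b a‖ ^ 2 * q b := by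
  rw [Finset.sum_comm]
  rw [Matrix.trace, Complex.re_sum]
  refine Finset.sum_congr rfl fun a _ => ?_
  rw [Matrix.diag_apply, Matrix.mul_apply, Complex.re_sum]
  refine Finset.sum_congr rfl fun b _ => ?_
  rw [Matrix.mul_diagonal, mul_right_comm, Complex.re_mul_ofReal, Matrix.conjTranspose_apply, Complex.star_def,
    ← Complex.normSq_eq_conj_mul_self, Complex.ofReal_re, Complex.normSq_eq_norm_sq]

lemma two_mul_re_star_mul_le {p q t : ℝ} (hp : 0 ≤ p) (hq : 0 ≤ q) (ht : 0 < t) (z m : ℂ) :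
    2 * ((star z * m).re * p) - ‖z‖ ^ 2 * q - t * ((star z * z).re * p) ≤
      ‖m‖ ^ 2 * p * (p / (q + t * p)) := by
  have hs : 0 ≤ q + t * p := by positivity
  rcases hs.eq_or_lt with h0 | h0
  · have hp0 : p = 0 := by nlinarith [mul_nonneg ht.le hp]
    have hq0 : q = 0 := by nlinarith [mul_nonneg ht.le hp]
    simp [hp0, hq0]
  · rw [mul_div_assoc', le_div_iff₀ h0]
    simp only [← Complex.normSq_eq_norm_sq, Complex.normSq_apply, Complex.star_def,
      Complex.mul_re, Complex.conj_re, Complex.conj_im]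
    nlinarith [sq_nonneg (z.re * (q + t * p) - m.re * p), sq_nonneg (z.im * (q + t * p) - m.im * p)]

lemma two_mul_re_star_mul_eq {p q t : ℝ} (hp : 0 ≤ p) (hq : 0 ≤ q) (ht : 0 < t) (m : ℂ) :
    let z : ℂ := ((p / (q + t * p) : ℝ) : ℂ) * m
    2 * ((star z * m).re * p) - ‖z‖ ^ 2 * q - t * ((star z * z).re * p) =
      ‖m‖ ^ 2 * p * (p / (q + t * p)) := by
  have hs : 0 ≤ q + t * p := by positivity
  have key : p / (q + t * p) * (p / (q + t * p)) * (q + t * p) = p / (q + t * p) * p := by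
    rcases hs.eq_or_lt with h0 | h0
    · simp [← h0]
    · field_simp
  generalize p / (q + t * p) = c at key
  simp only [← Complex.normSq_eq_norm_sq, Complex.normSq_apply, Complex.star_def,
    Complex.mul_re, Complex.mul_im, Complex.conj_re, Complex.conj_im, Complex.ofReal_re,
    Complex.ofReal_im]
  linear_combination (-(m.re ^ 2 + m.im ^ 2)) * key

/-- Diagonalizing the input and output of a channel reduces its entropy gain and its quadratic
functional to those of a classical transition. -/
lemma exists_isTransition (K : X → Matrix κ ι ℂ) (hK : ∑ x, (K x)ᴴ * K x = 1)
    {ρ : Matrix ι ι ℂ} (hρ : ρ.PosSemidef) :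
    ∃ (p : ι → ℝ) (q : κ → ℝ) (w : κ → ι → ℝ), IsTransition p q w ∧
      vnEntropy ρ = ∑ a, Real.negMulLog (p a) ∧
      vnEntropy (chanApply K ρ) = ∑ b, Real.negMulLog (q b) ∧
      ρ.trace.re = ∑ a, p a ∧
      ∀ t : ℝ, 0 < t → IsGreatest (Set.range (krausForm K ρ t))
        (∑ b, ∑ a, w b a * p a * (p a / (q b + t * p a))) := by
  have hσ := posSemidef_chanApply K hρ
  obtain ⟨U, hU, hU', hρU⟩ := exists_unitary_diagonal hρ.isHermitian
  obtain ⟨V, hV, hV', hσV⟩ := exists_unitary_diagonal hσ.isHermitian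
  set p := hρ.isHermitian.eigenvalues with hp
  set q := hσ.isHermitian.eigenvalues with hq
  set P : Matrix ι ι ℂ := diagonal fun a => (p a : ℂ) with hP
  set Q : Matrix κ κ ℂ := diagonal fun b => (q b : ℂ) with hQ
  set M : X → Matrix κ ι ℂ := fun x => Vᴴ * K x * U with hM
  have hp0 : ∀ a, 0 ≤ p a := hρ.eigenvalues_nonneg
  have hq0 : ∀ b, 0 ≤ q b := hσ.eigenvalues_nonneg
  have hKM : ∀ x, K x = V * M x * Uᴴ := fun x => by
    simp only [hM, Matrix.mul_assoc, hU', Matrix.mul_one]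
    rw [← Matrix.mul_assoc, hV', Matrix.one_mul]
  have hMM : ∑ x, (M x)ᴴ * M x = 1 := by
    have : ∀ x, (M x)ᴴ * M x = Uᴴ * ((K x)ᴴ * K x) * U := fun x => by
      calc (M x)ᴴ * M x = Uᴴ * (K x)ᴴ * (V * Vᴴ) * K x * U := by
            simp only [hM, Matrix.conjTranspose_mul, Matrix.conjTranspose_conjTranspose,
              Matrix.mul_assoc]
        _ = _ := by rw [hV']; simp only [Matrix.mul_one, Matrix.mul_assoc]
    simp_rw [this]
    rw [← Finset.sum_mul, ← Finset.mul_sum, hK, Matrix.mul_one, hU]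
  have hQM : Q = ∑ x, M x * P * (M x)ᴴ := by
    have : Q = Vᴴ * chanApply K ρ * V := by
      rw [hσV]
      calc Q = (Vᴴ * V) * Q * (Vᴴ * V) := by rw [hV, Matrix.one_mul, Matrix.mul_one]
        _ = _ := by simp only [Matrix.mul_assoc]
    rw [this, chanApply, Finset.mul_sum, Finset.sum_mul]
    refine Finset.sum_congr rfl fun x _ => ?_
    conv_lhs => rw [hρU]
    simp only [hM, Matrix.conjTranspose_mul, Matrix.conjTranspose_conjTranspose,
      Matrix.mul_assoc]
  have hw : ∀ b a, ∑ x, ‖M x b a‖ ^ 2 = (∑ x, star (M x b a) * M x b a).re := fun b a => by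
    rw [Complex.re_sum]
    refine Finset.sum_congr rfl fun x _ => ?_
    rw [Complex.star_def, ← Complex.normSq_eq_conj_mul_self, Complex.ofReal_re,
      Complex.normSq_eq_norm_sq]
  have htr : IsTransition p q (fun b a => ∑ x, ‖M x b a‖ ^ 2) := by
    refine ⟨hp0, fun b a => Finset.sum_nonneg fun x _ => by positivity, fun a => ?_, fun b => ?_⟩
    · have := congrArg Complex.re (congrFun (congrFun hMM a) a)
      simp only [Matrix.sum_apply, Matrix.mul_apply, Matrix.conjTranspose_apply,
        Matrix.one_apply_eq, Complex.one_re] at this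
      simp_rw [hw, ← Complex.re_sum]
      rw [Finset.sum_comm, this]
    · have := congrArg Complex.re (congrFun (congrFun hQM b) b)
      simp only [hP, hQ, Matrix.sum_apply, Matrix.mul_apply (N := (M _)ᴴ), Matrix.mul_diagonal,
        Matrix.conjTranspose_apply, Matrix.diagonal_apply_eq, Complex.ofReal_re] at this
      rw [this, Finset.sum_comm, Complex.re_sum]
      refine Finset.sum_congr rfl fun a _ => ?_
      rw [hw, ← Complex.re_mul_ofReal, Finset.sum_mul]
      congr 1
      exact Finset.sum_congr rfl fun x _ => by ring
  have hform : ∀ (t : ℝ) (Z : X → Matrix κ ι ℂ),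
      krausForm K ρ t (fun x => V * Z x * Uᴴ) = ∑ x, ∑ b, ∑ a,
        (2 * ((star (Z x b a) * M x b a).re * p a) - ‖Z x b a‖ ^ 2 * q b -
          t * ((star (Z x b a) * Z x b a).re * p a)) := by
    intro t Z
    have h1 : ∀ A B : Matrix κ ι ℂ,
        ((V * A * Uᴴ)ᴴ * (V * B * Uᴴ) * ρ).trace = (Aᴴ * B * P).trace := fun A B => by
      rw [hρU]
      calc _ = (U * (Aᴴ * (Vᴴ * V) * B * (Uᴴ * U) * P * Uᴴ)).trace := by
            simp only [Matrix.conjTranspose_mul, Matrix.conjTranspose_conjTranspose,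
              Matrix.mul_assoc]
        _ = _ := by
            rw [Matrix.trace_mul_comm, hU, hV, Matrix.mul_one, Matrix.mul_one, Matrix.mul_assoc _ _ U,
              hU, Matrix.mul_one]
    have h2 : ∀ A : Matrix κ ι ℂ,
        ((V * A * Uᴴ)ᴴ * chanApply K ρ * (V * A * Uᴴ)).trace = (Aᴴ * Q * A).trace := fun A => by
      rw [hσV]
      calc _ = (U * (Aᴴ * (Vᴴ * V) * Q * (Vᴴ * V) * A * Uᴴ)).trace := by
            simp only [Matrix.conjTranspose_mul, Matrix.conjTranspose_conjTranspose,
              Matrix.mul_assoc]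
        _ = _ := by
            rw [Matrix.trace_mul_comm, hV, Matrix.mul_one, Matrix.mul_one, Matrix.mul_assoc _ _ U,
              hU, Matrix.mul_one]
    refine Finset.sum_congr rfl fun x _ => ?_
    rw [h2, h1]
    conv_lhs => rw [hKM x]
    rw [h1, hP, hQ, re_trace_conjTranspose_mul_mul_diagonal,
      re_trace_conjTranspose_mul_mul_diagonal, re_trace_conjTranspose_mul_diagonal_mul]
    simp only [Finset.mul_sum, Finset.sum_sub_distrib]
  have hsum : ∀ t : ℝ, ∑ b, ∑ a, (∑ x, ‖M x b a‖ ^ 2) * p a * (p a / (q b + t * p a)) =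
      ∑ x, ∑ b, ∑ a, ‖M x b a‖ ^ 2 * p a * (p a / (q b + t * p a)) := fun t => by
    symm
    rw [Finset.sum_comm]
    refine Finset.sum_congr rfl fun b _ => ?_
    rw [Finset.sum_comm]
    refine Finset.sum_congr rfl fun a _ => ?_
    rw [Finset.sum_mul, Finset.sum_mul]
  refine ⟨p, q, _, htr, vnEntropy_eq _, vnEntropy_eq _, ?_, fun t ht => ⟨?_, ?_⟩⟩
  · rw [hρ.isHermitian.trace_eq_sum_eigenvalues]
    simp [hp]
  · refine ⟨_, (hform t fun x b a => ((p a / (q b + t * p a) : ℝ) : ℂ) * M x b a).trans ?_⟩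
    rw [hsum]
    refine Finset.sum_congr rfl fun x _ => Finset.sum_congr rfl fun b _ =>
      Finset.sum_congr rfl fun a _ => ?_
    exact two_mul_re_star_mul_eq (hp0 a) (hq0 b) ht (M x b a)
  · rintro _ ⟨Y, rfl⟩
    have hY : Y = fun x => V * (Vᴴ * Y x * U) * Uᴴ := funext fun x => by
      simp only [Matrix.mul_assoc, hU', Matrix.mul_one]
      rw [← Matrix.mul_assoc, hV', Matrix.one_mul]
    rw [hY, hform, hsum]
    refine Finset.sum_le_sum fun x _ => Finset.sum_le_sum fun b _ =>
      Finset.sum_le_sum fun a _ => ?_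
    exact two_mul_re_star_mul_le (hp0 a) (hq0 b) ht _ _

end Spectral

section PartialTrace

variable {ι κ B X : Type*} [Fintype ι] [Fintype κ] [Fintype B] [DecidableEq B] [Fintype X]

/-- The partial trace over the second tensor factor. -/
def partialTrace (ρ : Matrix (ι × B) (ι × B) ℂ) : Matrix ι ι ℂ :=
  ∑ b, ρ.submatrix (fun a => (a, b)) (fun a => (a, b))

omit [Fintype ι] [DecidableEq B] in
lemma partialTrace_apply (ρ : Matrix (ι × B) (ι × B) ℂ) (a a' : ι) :
    partialTrace ρ a a' = ∑ b, ρ (a, b) (a', b) := by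
  simp [partialTrace, Matrix.sum_apply]

omit [Fintype ι] [DecidableEq B] in
lemma posSemidef_partialTrace {ρ : Matrix (ι × B) (ι × B) ℂ} (hρ : ρ.PosSemidef) :
    (partialTrace ρ).PosSemidef :=
  Matrix.posSemidef_sum _ fun _ _ => hρ.submatrix _

omit [DecidableEq B] in
lemma trace_partialTrace (ρ : Matrix (ι × B) (ι × B) ℂ) :
    (partialTrace ρ).trace = ρ.trace := by
  simp [Matrix.trace, partialTrace_apply, Fintype.sum_prod_type]

lemma trace_kronecker_one_mul (A : Matrix ι ι ℂ) (ρ : Matrix (ι × B) (ι × B) ℂ) :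
    ((A ⊗ₖ (1 : Matrix B B ℂ)) * ρ).trace = (A * partialTrace ρ).trace := by
  simp only [Matrix.trace, Matrix.diag_apply, Matrix.mul_apply, Fintype.sum_prod_type,
    kronecker_apply, partialTrace_apply, Matrix.one_apply, mul_ite, mul_one, mul_zero, ite_mul,
    zero_mul, Finset.sum_ite_eq, Finset.mem_univ, if_true, Finset.mul_sum]
  exact Finset.sum_congr rfl fun a _ => Finset.sum_comm

omit [Fintype B] [DecidableEq B] in
lemma trace_mul_chanApply_mul (K : X → Matrix κ ι ℂ) (ρ : Matrix ι ι ℂ) (Y : Matrix κ ι ℂ) :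
    (Yᴴ * chanApply K ρ * Y).trace = ∑ x, ((K x)ᴴ * (Y * Yᴴ) * K x * ρ).trace := by
  rw [chanApply, Matrix.mul_sum, Matrix.sum_mul, Matrix.trace_sum]
  refine Finset.sum_congr rfl fun x _ => ?_
  calc (Yᴴ * (K x * ρ * (K x)ᴴ) * Y).trace = ((Yᴴ * K x * ρ) * ((K x)ᴴ * Y)).trace := by
        simp only [Matrix.mul_assoc]
    _ = _ := by rw [Matrix.trace_mul_comm]; simp only [Matrix.mul_assoc]

lemma krausForm_kronecker_one (K Y : X → Matrix κ ι ℂ) (ρ : Matrix (ι × B) (ι × B) ℂ) (t : ℝ) :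
    krausForm (fun x => K x ⊗ₖ (1 : Matrix B B ℂ)) ρ t (fun x => Y x ⊗ₖ (1 : Matrix B B ℂ)) =
      krausForm K (partialTrace ρ) t Y := by
  simp only [krausForm, trace_mul_chanApply_mul]
  simp only [conjTranspose_kronecker, conjTranspose_one,
    ← mul_kronecker_mul, Matrix.one_mul, trace_kronecker_one_mul]

/-- Monotonicity of the entropy gain under enlarging the reference system. -/
lemma entropy_gain_partialTrace_le [DecidableEq ι] [DecidableEq κ] (K : X → Matrix κ ι ℂ)
    (hK : ∑ x, (K x)ᴴ * K x = 1) {ρ : Matrix (ι × B) (ι × B) ℂ} (hρ : ρ.PosSemidef) :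
    vnEntropy (chanApply K (partialTrace ρ)) - vnEntropy (partialTrace ρ) ≤
      vnEntropy (chanApply (fun x => K x ⊗ₖ (1 : Matrix B B ℂ)) ρ) - vnEntropy ρ := by
  have hK' : ∑ x, (K x ⊗ₖ (1 : Matrix B B ℂ))ᴴ * (K x ⊗ₖ (1 : Matrix B B ℂ)) = 1 := by
    simp only [conjTranspose_kronecker, conjTranspose_one, ← mul_kronecker_mul, Matrix.one_mul]
    rw [← one_kronecker_one, ← hK]
    ext u v
    simp [Matrix.sum_apply, Finset.sum_mul]
  obtain ⟨p, q, w, h, hp, hq, htr, hF⟩ :=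
    exists_isTransition K hK (posSemidef_partialTrace hρ)
  obtain ⟨p', q', w', h', hp', hq', htr', hF'⟩ := exists_isTransition _ hK' hρ
  rw [hp, hq, hp', hq']
  refine h.sum_negMulLog_sub_le h' ?_ fun t ht => ?_
  · rw [← htr, ← htr', trace_partialTrace]
  · obtain ⟨Y, hY⟩ := (hF t ht).1
    rw [← hY, ← krausForm_kronecker_one]
    exact (hF' t ht).2 ⟨_, rfl⟩

omit [Fintype κ] [Fintype B] [DecidableEq B] in
lemma chanApply_submatrix {ι' κ' : Type*} [Fintype ι'] (L : X → Matrix κ ι ℂ) (f : κ' → κ)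
    (e : ι ≃ ι') (ρ : Matrix ι' ι' ℂ) :
    chanApply (fun x => (L x).submatrix f e.symm) ρ =
      (chanApply L (ρ.submatrix e e)).submatrix f f := by
  ext u v
  simp only [chanApply, Matrix.sum_apply, Matrix.submatrix_apply]
  refine Finset.sum_congr rfl fun x _ => ?_
  simp only [Matrix.mul_apply, Matrix.conjTranspose_apply, Matrix.submatrix_apply]
  rw [← e.sum_comp]
  refine Finset.sum_congr rfl fun a _ => ?_
  rw [← e.sum_comp]
  simp

lemma entropy_gain_submatrix_le {ι' κ' : Type*} [Fintype ι'] [DecidableEq ι'] [Fintype κ']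
    [DecidableEq κ'] [DecidableEq ι] [DecidableEq κ] (K : X → Matrix κ ι ℂ)
    (hK : ∑ x, (K x)ᴴ * K x = 1) (eι : ι × B ≃ ι') (eκ : κ' ≃ κ × B)
    {ρ : Matrix ι' ι' ℂ} (hρ : ρ.PosSemidef) :
    vnEntropy (chanApply K (partialTrace (ρ.submatrix eι eι))) -
        vnEntropy (partialTrace (ρ.submatrix eι eι)) ≤
      vnEntropy (chanApply (fun x => (K x ⊗ₖ (1 : Matrix B B ℂ)).submatrix eκ eι.symm) ρ) -
        vnEntropy ρ := by
  rw [chanApply_submatrix, vnEntropy_submatrix, ← vnEntropy_submatrix ρ eι]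
  exact entropy_gain_partialTrace_le K hK (hρ.submatrix _)

omit [Fintype κ] in
lemma chanApply_kronecker_one_apply (K : X → Matrix κ ι ℂ) (ρ : Matrix (ι × B) (ι × B) ℂ)
    (k k' : κ) (b b' : B) :
    chanApply (fun x => K x ⊗ₖ (1 : Matrix B B ℂ)) ρ (k, b) (k', b') =
      chanApply K (ρ.submatrix (fun a => (a, b)) (fun a => (a, b'))) k k' := by
  simp only [chanApply, Matrix.sum_apply, Matrix.mul_apply, Matrix.conjTranspose_apply,
    kronecker_apply, Fintype.sum_prod_type, Matrix.one_apply, Matrix.submatrix_apply]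
  simp [Finset.sum_ite_eq, apply_ite, ite_mul]

omit [Fintype B] [DecidableEq B] in
lemma trace_chanApply [DecidableEq ι] (K : X → Matrix κ ι ℂ) (hK : ∑ x, (K x)ᴴ * K x = 1)
    (τ : Matrix ι ι ℂ) : (chanApply K τ).trace = τ.trace := by
  rw [chanApply, Matrix.trace_sum]
  simp_rw [Matrix.trace_mul_comm _ (K _)ᴴ, ← Matrix.mul_assoc]
  rw [← Matrix.trace_sum, ← Finset.sum_mul, hK, Matrix.one_mul]

end PartialTrace

section Tensor

variable {ιA ιA' ιR ι : Type*} [Fintype ιA] [DecidableEq ιA] [Fintype ιA'] [DecidableEq ιA']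
  [Fintype ιR] [DecidableEq ιR] [Fintype ι]

omit [Fintype ιR] [DecidableEq ιR] in
lemma reduceAR_eq_sum_insertNth {n : ℕ}
    (ρ : Matrix ((Fin (n + 1) → ιA) × ιR) ((Fin (n + 1) → ιA) × ιR) ℂ) (d : Fin (n + 1)) :
    reduceAR ρ d = fun p q => ∑ g : Fin n → ιA,
      ρ (d.insertNth p.1 g, p.2) (d.insertNth q.1 g, q.2) := by
  funext p q
  rw [reduceAR, ← (Fin.insertNthEquiv (fun _ => ιA) d).sum_comp, Fintype.sum_prod_type,
    Finset.sum_comm]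
  simp [Fin.insertNthEquiv]

omit [Fintype ιR] [DecidableEq ιR] in
lemma posSemidef_reduceAR {D : ℕ} {ρ : Matrix ((Fin D → ιA) × ιR) ((Fin D → ιA) × ιR) ℂ}
    (hρ : ρ.PosSemidef) (d : Fin D) : (reduceAR ρ d).PosSemidef := by
  obtain _ | n := D
  · exact d.elim0
  have : reduceAR ρ d = ∑ g : Fin n → ιA,
      ρ.submatrix (fun p => (d.insertNth p.1 g, p.2)) (fun p => (d.insertNth p.1 g, p.2)) := by
    rw [reduceAR_eq_sum_insertNth]
    ext p q
    simp [Matrix.sum_apply]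
  rw [this]
  exact Matrix.posSemidef_sum _ fun _ _ => hρ.submatrix _

omit [Fintype ιA] [DecidableEq ιA'] in
lemma sum_krausIdR (K : ι → Matrix ιA' ιA ℂ) (hK : ∑ i, (K i)ᴴ * K i = 1) :
    ∑ i, (krausIdR (ιR := ιR) K i)ᴴ * krausIdR (ιR := ιR) K i = 1 := by
  simp only [krausIdR, conjTranspose_kronecker, conjTranspose_one, ← mul_kronecker_mul,
    Matrix.one_mul]
  rw [← one_kronecker_one, ← hK]
  ext u v
  simp [Matrix.sum_apply, Finset.sum_mul]

/-- Splitting off the first of `n + 1` factors. -/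
def consProdEquiv (n : ℕ) (α β : Type*) : (α × β) × (Fin n → α) ≃ (Fin (n + 1) → α) × β where
  toFun x := (Fin.cons x.1.1 x.2, x.1.2)
  invFun y := ((y.1 0, y.2), Fin.tail y.1)
  left_inv x := by simp
  right_inv y := by simp

/-- Kraus operators applying `K` to the first of `n + 1` factors, moving its output into the
reference system. -/
def headKraus (n : ℕ) (K : ι → Matrix ιA' ιA ℂ) (i : ι) :
    Matrix ((Fin n → ιA) × (ιA' × ιR)) ((Fin (n + 1) → ιA) × ιR) ℂ :=
  (krausIdR (ιR := ιR) K i ⊗ₖ (1 : Matrix (Fin n → ιA) (Fin n → ιA) ℂ)).submatrix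
    (Equiv.prodComm _ _) (consProdEquiv n ιA ιR).symm

omit [Fintype ιR] [DecidableEq ιR] in
lemma partialTrace_consProdEquiv {n : ℕ}
    (ρ : Matrix ((Fin (n + 1) → ιA) × ιR) ((Fin (n + 1) → ιA) × ιR) ℂ) :
    partialTrace (ρ.submatrix (consProdEquiv n ιA ιR) (consProdEquiv n ιA ιR)) =
      reduceAR ρ 0 := by
  rw [reduceAR_eq_sum_insertNth]
  ext p q
  simp [partialTrace_apply, consProdEquiv]

omit [DecidableEq ιA'] in
lemma sum_chanApply_headKraus {n : ℕ} (K : ι → Matrix ιA' ιA ℂ) (hK : ∑ i, (K i)ᴴ * K i = 1)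
    (ρ : Matrix ((Fin (n + 1) → ιA) × ιR) ((Fin (n + 1) → ιA) × ιR) ℂ) (f g : Fin n → ιA)
    (r s : ιR) :
    ∑ b, chanApply (headKraus n K) ρ (f, (b, r)) (g, (b, s)) =
      ∑ a, ρ (Fin.cons a f, r) (Fin.cons a g, s) := by
  have : ∀ b, chanApply (headKraus n K) ρ (f, (b, r)) (g, (b, s)) =
      chanApply K (fun a a' => ρ (Fin.cons a f, r) (Fin.cons a' g, s)) b b := fun b => by
    unfold headKraus
    rw [chanApply_submatrix, Matrix.submatrix_apply]
    simp only [Equiv.prodComm_apply, Prod.swap_prod_mk]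
    rw [chanApply_kronecker_one_apply]
    unfold krausIdR
    rw [chanApply_kronecker_one_apply]
    rfl
  simp_rw [this]
  exact trace_chanApply K hK _

omit [DecidableEq ιA'] in
lemma partialTrace_reduceAR_headKraus {n : ℕ} (K : ι → Matrix ιA' ιA ℂ)
    (hK : ∑ i, (K i)ᴴ * K i = 1)
    (ρ : Matrix ((Fin (n + 1) → ιA) × ιR) ((Fin (n + 1) → ιA) × ιR) ℂ) (d : Fin n)
    (e : (ιA × ιR) × ιA' ≃ ιA × (ιA' × ιR)) (he : ∀ a r b, e ((a, r), b) = (a, (b, r))) :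
    partialTrace ((reduceAR (chanApply (headKraus n K) ρ) d).submatrix e e) =
      reduceAR ρ d.succ := by
  ext ⟨a, r⟩ ⟨a', s⟩
  simp only [partialTrace_apply, Matrix.submatrix_apply, he]
  simp only [reduceAR]
  rw [← (Fin.consEquiv fun _ => ιA).sum_comp, Fintype.sum_prod_type, Finset.sum_comm,
    Finset.sum_comm (s := (Finset.univ : Finset ιA))]
  refine Finset.sum_congr rfl fun f _ => ?_
  have hupd : ∀ x, Function.update (Fin.consEquiv (fun _ => ιA) (x, f)) d.succ a =
      Fin.cons x (Function.update f d a) := fun x => (Fin.cons_update ..).symm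
  simp only [hupd, Fin.consEquiv_apply, Fin.cons_succ]
  split_ifs
  · exact sum_chanApply_headKraus K hK ρ _ _ _ _
  · simp

/-- Splitting off the first of `n + 1` factors into the reference system. -/
def splitHeadEquiv (n : ℕ) (α β : Type*) : (Fin (n + 1) → α) × β ≃ (Fin n → α) × (α × β) :=
  (consProdEquiv n α β).symm.trans (Equiv.prodComm _ _)

omit [Fintype ιA] [DecidableEq ιA] [Fintype ιA'] [DecidableEq ιA'] [Fintype ι] in
lemma tensorKrausR_apply {D : ℕ} (K : Fin D → ι → Matrix ιA' ιA ℂ) (i : Fin D → ι)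
    (f : Fin D → ιA') (g : Fin D → ιA) (r s : ιR) :
    tensorKrausR K i (f, r) (g, s) = (∏ d, K d (i d) (f d) (g d)) * (1 : Matrix ιR ιR ℂ) r s :=
  rfl

omit [Fintype ι] in
lemma tensorKrausR_cons {n : ℕ} (K : Fin (n + 1) → ι → Matrix ιA' ιA ℂ) (i₀ : ι)
    (i : Fin n → ι) :
    tensorKrausR (ιR := ιR) K (Fin.cons i₀ i) =
      (tensorKrausR (ιR := ιA' × ιR) (fun d => K d.succ) i *
        headKraus (ιR := ιR) n (K 0) i₀).submatrix
        (splitHeadEquiv n ιA' ιR) id := by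
  ext ⟨f, r⟩ ⟨g, s⟩
  simp only [tensorKrausR_apply, headKraus, krausIdR, splitHeadEquiv, consProdEquiv, kronecker_apply,
    Matrix.submatrix_apply, Matrix.mul_apply, Fintype.sum_prod_type, Fin.prod_univ_succ,
    Fin.cons_zero, Fin.cons_succ, Matrix.one_apply, Prod.mk.injEq, Equiv.trans_apply,
    Equiv.coe_fn_symm_mk, Equiv.prodComm_apply, Prod.swap_prod_mk, id, ite_and]
  simp [Fin.tail]
  ring_nf

lemma chanApply_tensorKrausR_succ {n : ℕ} (K : Fin (n + 1) → ι → Matrix ιA' ιA ℂ)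
    (ρ : Matrix ((Fin (n + 1) → ιA) × ιR) ((Fin (n + 1) → ιA) × ιR) ℂ) :
    chanApply (tensorKrausR K) ρ =
      (chanApply (tensorKrausR fun d => K d.succ) (chanApply (headKraus n (K 0)) ρ)).submatrix
        (splitHeadEquiv n ιA' ιR) (splitHeadEquiv n ιA' ιR) := by
  let L (i₀ : ι) (i : Fin n → ι) : Matrix ((Fin n → ιA') × (ιA' × ιR)) ((Fin (n + 1) → ιA) × ιR) ℂ :=
    tensorKrausR (ιR := ιA' × ιR) (fun d => K d.succ) i * headKraus (ιR := ιR) n (K 0) i₀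
  have : chanApply (tensorKrausR fun d => K d.succ) (chanApply (headKraus n (K 0)) ρ) =
      ∑ i₀, ∑ i, L i₀ i * ρ * (L i₀ i)ᴴ := by
    rw [Finset.sum_comm]
    simp only [L, chanApply, Matrix.mul_sum, Matrix.sum_mul, Matrix.conjTranspose_mul,
      Matrix.mul_assoc]
  rw [this, chanApply, ← (Fin.consEquiv fun _ => ι).sum_comp, Fintype.sum_prod_type]
  have hcons : ∀ i₀ i, tensorKrausR (ιR := ιR) K (Fin.consEquiv (fun _ => ι) (i₀, i)) =
      (L i₀ i).submatrix (splitHeadEquiv n ιA' ιR) id := fun i₀ i => tensorKrausR_cons K i₀ i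
  ext u v
  simp only [hcons, Matrix.sum_apply, Matrix.submatrix_apply, Matrix.mul_apply,
    Matrix.conjTranspose_apply, id]

/-- Superadditivity of the entropy gain for `n + 1` factors follows from that for `n` factors and
the enlarged reference system `A' × R`. -/
lemma entropy_gain_superadditive_succ {n : ℕ}
    (ih : ∀ (K : Fin n → ι → Matrix ιA' ιA ℂ), (∀ d, ∑ i, (K d i)ᴴ * K d i = 1) →
      ∀ (ρ : Matrix ((Fin n → ιA) × (ιA' × ιR)) ((Fin n → ιA) × (ιA' × ιR)) ℂ), ρ.PosSemidef →
        ∑ d, (vnEntropy (chanApply (krausIdR (K d)) (reduceAR ρ d)) - vnEntropy (reduceAR ρ d)) ≤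
          vnEntropy (chanApply (tensorKrausR K) ρ) - vnEntropy ρ)
    (K : Fin (n + 1) → ι → Matrix ιA' ιA ℂ) (hK : ∀ d, ∑ i, (K d i)ᴴ * K d i = 1)
    (ρ : Matrix ((Fin (n + 1) → ιA) × ιR) ((Fin (n + 1) → ιA) × ιR) ℂ) (hρ : ρ.PosSemidef) :
    ∑ d, (vnEntropy (chanApply (krausIdR (K d)) (reduceAR ρ d)) - vnEntropy (reduceAR ρ d)) ≤
      vnEntropy (chanApply (tensorKrausR K) ρ) - vnEntropy ρ := by
  set σ := chanApply (headKraus n (K 0)) ρ with hσdef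
  have hσ : σ.PosSemidef := posSemidef_chanApply _ hρ
  have hhead : vnEntropy (chanApply (krausIdR (K 0)) (reduceAR ρ 0)) - vnEntropy (reduceAR ρ 0) ≤
      vnEntropy σ - vnEntropy ρ := by
    rw [← partialTrace_consProdEquiv]
    exact entropy_gain_submatrix_le _ (sum_krausIdR (K 0) (hK 0)) (consProdEquiv n ιA ιR)
      (Equiv.prodComm _ _) hρ
  have htail : ∀ d : Fin n,
      vnEntropy (chanApply (krausIdR (K d.succ)) (reduceAR ρ d.succ)) -
          vnEntropy (reduceAR ρ d.succ) ≤
        vnEntropy (chanApply (krausIdR (K d.succ)) (reduceAR σ d)) -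
          vnEntropy (reduceAR σ d) := fun d => by
    let e : (ιA × ιR) × ιA' ≃ ιA × (ιA' × ιR) :=
      (Equiv.prodAssoc _ _ _).trans ((Equiv.refl _).prodCongr (Equiv.prodComm _ _))
    let e' : (ιA' × ιR) × ιA' ≃ ιA' × (ιA' × ιR) :=
      (Equiv.prodAssoc _ _ _).trans ((Equiv.refl _).prodCongr (Equiv.prodComm _ _))
    rw [← partialTrace_reduceAR_headKraus (K 0) (hK 0) ρ d e fun _ _ _ => rfl]
    refine (entropy_gain_submatrix_le _ (sum_krausIdR (K d.succ) (hK d.succ)) e e'.symm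
      (posSemidef_reduceAR hσ d)).trans_eq ?_
    congr 3
    funext x
    ext ⟨a, b, r⟩ ⟨a', b', r'⟩
    simp [krausIdR, e, e', Matrix.one_apply, ite_and, Prod.ext_iff]
  have hstep := ih (fun d => K d.succ) (fun d => hK d.succ) σ hσ
  rw [chanApply_tensorKrausR_succ, vnEntropy_submatrix, Fin.sum_univ_succ]
  have := Finset.sum_le_sum fun d (_ : d ∈ Finset.univ) => htail d
  linarith

end Tensor

/-- Superadditivity of the entropy gain, with the reference system in a universe closed under
products with `ιA'`. -/
lemma entropy_gain_superadditive.{u, v, w, x} {ιA : Type u} {ιA' : Type v} {ι : Type w}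
    [Fintype ιA] [DecidableEq ιA] [Fintype ιA'] [DecidableEq ιA'] [Fintype ι] (n : ℕ) :
    ∀ (ιR : Type (max v x)) [Fintype ιR] [DecidableEq ιR] (K : Fin n → ι → Matrix ιA' ιA ℂ),
      (∀ d, ∑ i, (K d i)ᴴ * K d i = 1) →
      ∀ (ρ : Matrix ((Fin n → ιA) × ιR) ((Fin n → ιA) × ιR) ℂ), ρ.PosSemidef →
        ∑ d, (vnEntropy (chanApply (krausIdR (K d)) (reduceAR ρ d)) - vnEntropy (reduceAR ρ d)) ≤
          vnEntropy (chanApply (tensorKrausR K) ρ) - vnEntropy ρ := by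
  induction n with
  | zero =>
    intro ιR _ _ K hK ρ hρ
    let e : (Fin 0 → ιA') × ιR ≃ (Fin 0 → ιA) × ιR :=
      (Equiv.ofUnique _ _).prodCongr (Equiv.refl _)
    have : chanApply (tensorKrausR K) ρ = ρ.submatrix e e := by
      have h1 : ∀ i, tensorKrausR (ιR := ιR) K i =
          (1 : Matrix ((Fin 0 → ιA) × ιR) ((Fin 0 → ιA) × ιR) ℂ).submatrix e (Equiv.refl _).symm := by
        intro i
        ext ⟨f, r⟩ ⟨g, s⟩
        simp [tensorKrausR_apply, e, Matrix.one_apply, eq_iff_true_of_subsingleton]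
      rw [funext h1, chanApply_submatrix]
      simp [chanApply]
    rw [this, vnEntropy_submatrix]
    simp
  | succ n ih =>
    intro ιR _ _ K hK ρ hρ
    exact entropy_gain_superadditive_succ (ih (ιA' × ιR)) K hK ρ hρ

/-- Superadditivity of entropy gain II: applying channels to each factor `A_d` while
leaving `R` unchanged, the global entropy gain is at least the sum of the entropy gains
on the reduced states on the pairs `(A_d, R)`. -/
theorem stmt7 (D : ℕ) (hD : 1 ≤ D) {ιA ιA' ιR ι : Type*}
    [Fintype ιA] [DecidableEq ιA] [Fintype ιA'] [DecidableEq ιA']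
    [Fintype ιR] [DecidableEq ιR] [Fintype ι]
    (K : Fin D → ι → Matrix ιA' ιA ℂ)
    (hK : ∀ d : Fin D, ∑ i, (K d i)ᴴ * K d i = 1)
    (ρ : Matrix ((Fin D → ιA) × ιR) ((Fin D → ιA) × ιR) ℂ)
    (hρ : IsDensityMatrix ρ) :
    vnEntropy (chanApply (tensorKrausR K) ρ) - vnEntropy ρ ≥
      ∑ d : Fin D,
        (vnEntropy (chanApply (krausIdR (K d)) (reduceAR ρ d)) -
          vnEntropy (reduceAR ρ d)) := by
  obtain ⟨n, rfl⟩ := Nat.exists_eq_add_of_le' hD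
  exact entropy_gain_superadditive_succ (entropy_gain_superadditive n (ιA' × ιR)) K hK ρ hρ.1
end
end
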